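/- arXiv:1810.09503 — 8 statements merged into one kernel-verified Lean document; each statement's English description precedes it below -/
import Mathlib

section
/- Let φ: ℝ → (0,∞) be a strictly increasing deformed exponential function which is twice differentiable with φ' > 0, whose inverse φ⁻¹ on (0,∞) is twice differentiable with (φ⁻¹)' > 0 and (φ⁻¹)'' continuous and strictly negative, and set g(x) = −(φ⁻¹)'(x)/(φ⁻¹)''(x). Suppose g is superadditive on (0,1), i.e., g(x+y) ≥ g(x) + g(y) whenever x, y, x+y ∈ (0,1). Then for every n, every partition 𝒜 = {A₁,…,A_k} of {1,…,n}, and all probability distributions p = (p_i), q = (q_i) with strictly positive entries, the generalized divergence satisfies D_φ(p‖q) ≥ D_φ(p^𝒜‖q^𝒜), where p^𝒜_j = ∑_{i∈A_j} p_i and q^𝒜_j = ∑_{i∈A_j} q_i. -/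
open Filter Set

/-- Superadditivity on `(0, 1)` of a function continuous on `(0, ∞)` extends to sums equal
to `1`. -/
lemma superadditive_of_add_le_one {g : ℝ → ℝ} (hg : ContinuousOn g (Ioi 0))
    (hsuper : ∀ x y : ℝ, x ∈ Ioo (0:ℝ) 1 → y ∈ Ioo (0:ℝ) 1 →
      x + y ∈ Ioo (0:ℝ) 1 → g x + g y ≤ g (x + y))
    {x y : ℝ} (hx : 0 < x) (hy : 0 < y) (hxy : x + y ≤ 1) : g x + g y ≤ g (x + y) := by
  have hcont : ∀ z : ℝ, 0 < z → ContinuousAt g z := fun z hz =>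
    hg.continuousAt (Ioi_mem_nhds hz)
  have hleft : Tendsto (fun z => g z + g y) (nhdsWithin x (Iio x)) (nhds (g x + g y)) :=
    ((hcont x hx).tendsto.add_const _).mono_left nhdsWithin_le_nhds
  have hright : Tendsto (fun z => g (z + y)) (nhdsWithin x (Iio x)) (nhds (g (x + y))) := by
    have hshift : ContinuousAt (fun z => g (z + y)) x :=
      ContinuousAt.comp (f := fun z => z + y) (hcont (x + y) (by positivity)) (by fun_prop)
    exact hshift.tendsto.mono_left nhdsWithin_le_nhds
  refine le_of_tendsto_of_tendsto hleft hright ?_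
  filter_upwards [self_mem_nhdsWithin, mem_nhdsWithin_of_mem_nhds (Ioi_mem_nhds hx)]
    with z hzx hz
  simp only [mem_Iio, mem_Ioi] at hzx hz
  exact hsuper z y ⟨hz, by linarith⟩ ⟨hy, by linarith⟩ ⟨by linarith, by linarith⟩

/-- A weighted Cauchy-Schwarz inequality for two terms. -/
lemma add_sq_le_mul_div_add_div {a b c d e : ℝ} (hc : 0 < c) (hd : 0 < d) (he : c + d ≤ e) :
    (a + b) ^ 2 ≤ e * (a ^ 2 / c + b ^ 2 / d) := by
  have hcd : (c + d) * (a ^ 2 / c + b ^ 2 / d) - (a + b) ^ 2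
      = (a * d - b * c) ^ 2 / (c * d) := by
    field_simp
    ring
  have hsq : 0 ≤ (a * d - b * c) ^ 2 / (c * d) := by positivity
  have hmono : (c + d) * (a ^ 2 / c + b ^ 2 / d) ≤ e * (a ^ 2 / c + b ^ 2 / d) := by gcongr
  linarith

/-- The second derivative of the inverse of `ψ`, in terms of the derivatives of `ψ`. -/
lemma second_deriv_eq_of_leftInverse {φ φ' φ'' ψ ψ' ψ'' : ℝ → ℝ}
    (hφpos : ∀ u, 0 < φ u)
    (hφd : ∀ u, HasDerivAt φ (φ' u) u) (hφd2 : ∀ u, HasDerivAt φ' (φ'' u) u)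
    (hinv : ∀ u, ψ (φ u) = u)
    (hψd : ∀ x : ℝ, 0 < x → HasDerivAt ψ (ψ' x) x)
    (hψd2 : ∀ x : ℝ, 0 < x → HasDerivAt ψ' (ψ'' x) x) (u : ℝ) :
    ψ' (φ u) * φ' u = 1 ∧ ψ'' (φ u) * φ' u ^ 2 + ψ' (φ u) * φ'' u = 0 := by
  have hone : ∀ v, ψ' (φ v) * φ' v = 1 := fun v => by
    have hcomp : HasDerivAt (fun t => ψ (φ t)) (ψ' (φ v) * φ' v) v :=
      (hψd _ (hφpos v)).comp v (hφd v)
    simp only [hinv] at hcomp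
    exact hcomp.unique (hasDerivAt_id v)
  refine ⟨hone u, ?_⟩
  have hmul : HasDerivAt (fun t => ψ' (φ t) * φ' t)
      (ψ'' (φ u) * φ' u * φ' u + ψ' (φ u) * φ'' u) u :=
    ((hψd2 _ (hφpos u)).comp u (hφd u)).mul (hφd2 u)
  simp only [hone] at hmul
  have heq := hmul.unique (hasDerivAt_const u (1:ℝ))
  linear_combination heq

/-- Subadditivity of the summand of the generalized divergence. -/
lemma divergence_term_subadditive {φ φ' φ'' ψ ψ' ψ'' g : ℝ → ℝ}
    (hφpos : ∀ u, 0 < φ u) (hφconv : ConvexOn ℝ univ φ)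
    (hφd : ∀ u, HasDerivAt φ (φ' u) u) (hφd2 : ∀ u, HasDerivAt φ' (φ'' u) u)
    (hinv_left : ∀ u, ψ (φ u) = u) (hinv_right : ∀ x : ℝ, 0 < x → φ (ψ x) = x)
    (hψd : ∀ x : ℝ, 0 < x → HasDerivAt ψ (ψ' x) x)
    (hψd2 : ∀ x : ℝ, 0 < x → HasDerivAt ψ' (ψ'' x) x)
    (hψ'pos : ∀ x : ℝ, 0 < x → 0 < ψ' x) (hψ''neg : ∀ x : ℝ, 0 < x → ψ'' x < 0)
    (hg : ∀ x, g x = -ψ' x / ψ'' x)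
    (hsuper : ∀ x y : ℝ, 0 < x → 0 < y → x + y ≤ 1 → g x + g y ≤ g (x + y))
    {x₁ x₂ y₁ y₂ : ℝ} (hx₁ : 0 < x₁) (hx₂ : 0 < x₂) (hy₁ : 0 < y₁) (hy₂ : 0 < y₂)
    (hx : x₁ + x₂ ≤ 1) (hy : y₁ + y₂ ≤ 1) :
    (ψ (x₁ + x₂) - ψ (y₁ + y₂)) / ψ' (x₁ + x₂) ≤
      (ψ x₁ - ψ y₁) / ψ' x₁ + (ψ x₂ - ψ y₂) / ψ' x₂ := by
  have hrel := second_deriv_eq_of_leftInverse hφpos hφd hφd2 hinv_left hψd hψd2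
  have hgpos : ∀ x, 0 < x → 0 < g x := fun x hx => by
    rw [hg]; exact div_pos_of_neg_of_neg (neg_neg_of_pos (hψ'pos x hx)) (hψ''neg x hx)
  have hψ'eq : ∀ x, 0 < x → ψ' x = -ψ'' x * g x := fun x hx => by
    have := (hψ''neg x hx).ne
    rw [hg]; field_simp
  have hφ''eq : ∀ u, φ'' u = φ' u ^ 2 / g (φ u) := fun u => by
    have h2 := (hrel u).2
    have hne := (hψ''neg _ (hφpos u)).ne
    have hgne := (hgpos _ (hφpos u)).ne'
    rw [hψ'eq _ (hφpos u)] at h2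
    rw [eq_div_iff hgne]
    apply mul_left_cancel₀ hne
    linear_combination -h2
  set w₁ := ψ y₁ - ψ x₁ with hw₁
  set w₂ := ψ y₂ - ψ x₂ with hw₂
  -- The segment from `(ψ x₁, ψ x₂)` to `(ψ y₁, ψ y₂)`.
  let u₁ : ℝ → ℝ := fun t => ψ x₁ + t * w₁
  let u₂ : ℝ → ℝ := fun t => ψ x₂ + t * w₂
  let s : ℝ → ℝ := fun t => φ (u₁ t) + φ (u₂ t)
  let s' : ℝ → ℝ := fun t => φ' (u₁ t) * w₁ + φ' (u₂ t) * w₂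
  have hu₁ : ∀ t, HasDerivAt u₁ w₁ t := fun t => by
    simpa [u₁] using (hasDerivAt_id t).mul_const w₁
  have hu₂ : ∀ t, HasDerivAt u₂ w₂ t := fun t => by
    simpa [u₂] using (hasDerivAt_id t).mul_const w₂
  have hspos : ∀ t, 0 < s t := fun t => add_pos (hφpos _) (hφpos _)
  have hs : ∀ t, HasDerivAt s (s' t) t := fun t =>
    ((hφd _).comp t (hu₁ t)).add ((hφd _).comp t (hu₂ t))
  have hs' : ∀ t, HasDerivAt s' (φ'' (u₁ t) * w₁ * w₁ + φ'' (u₂ t) * w₂ * w₂) t := fun t =>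
    (((hφd2 _).comp t (hu₁ t)).mul_const w₁).add (((hφd2 _).comp t (hu₂ t)).mul_const w₂)
  have hf : ∀ t, HasDerivAt (fun t => ψ (s t)) (ψ' (s t) * s' t) t := fun t =>
    (hψd _ (hspos t)).comp t (hs t)
  have hf' : ∀ t, HasDerivAt (fun t => ψ' (s t) * s' t)
      (ψ'' (s t) * s' t * s' t +
        ψ' (s t) * (φ'' (u₁ t) * w₁ * w₁ + φ'' (u₂ t) * w₂ * w₂)) t := fun t =>
    ((hψd2 _ (hspos t)).comp t (hs t)).mul (hs' t)
  have hchord : ∀ {x y t : ℝ}, 0 < x → 0 < y → t ∈ Icc (0:ℝ) 1 →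
      φ (ψ x + t * (ψ y - ψ x)) ≤ (1 - t) * x + t * y := fun {x y t} hx hy ht => by
    have hc := hφconv.2 (mem_univ (ψ x)) (mem_univ (ψ y)) (sub_nonneg.2 ht.2) ht.1
      (sub_add_cancel 1 t)
    simp only [smul_eq_mul, hinv_right x hx, hinv_right y hy] at hc
    rwa [show (1 - t) * ψ x + t * ψ y = ψ x + t * (ψ y - ψ x) by ring] at hc
  have hsle : ∀ t ∈ Icc (0:ℝ) 1, s t ≤ 1 := fun t ht => by
    have h₁ := hchord hx₁ hy₁ ht
    have h₂ := hchord hx₂ hy₂ ht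
    have h₃ := mul_le_mul_of_nonneg_left hx (sub_nonneg.2 ht.2)
    have h₄ := mul_le_mul_of_nonneg_left hy ht.1
    simp only [s, u₁, u₂, hw₁, hw₂]
    linarith
  have hconv : ConvexOn ℝ (Icc (0:ℝ) 1) (fun t => ψ (s t)) := by
    refine convexOn_of_hasDerivWithinAt2_nonneg (convex_Icc 0 1)
      (fun t _ => (hf t).continuousAt.continuousWithinAt)
      (fun t _ => (hf t).hasDerivWithinAt) (fun t _ => (hf' t).hasDerivWithinAt) ?_
    intro t ht
    have hcs := add_sq_le_mul_div_add_div (a := φ' (u₁ t) * w₁) (b := φ' (u₂ t) * w₂)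
      (hgpos _ (hφpos (u₁ t))) (hgpos _ (hφpos (u₂ t)))
      (hsuper _ _ (hφpos _) (hφpos _) (hsle t (interior_subset ht)))
    have hmul := mul_le_mul_of_nonneg_left hcs (neg_nonneg.2 (hψ''neg _ (hspos t)).le)
    rw [hψ'eq _ (hspos t), hφ''eq, hφ''eq]
    simp only [s, s'] at hmul ⊢
    linear_combination hmul
  have hslope := hconv.le_slope_of_hasDerivAt (left_mem_Icc.2 zero_le_one)
    (right_mem_Icc.2 zero_le_one) zero_lt_one (hf 0)
  have hφ' : ∀ x, 0 < x → φ' (ψ x) = 1 / ψ' x := fun x hx => by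
    have h1 := (hrel (ψ x)).1
    rw [hinv_right x hx] at h1
    rw [eq_div_iff (hψ'pos x hx).ne']
    linarith
  have hpos := hψ'pos (x₁ + x₂) (by positivity)
  simp only [slope_def_field, s, s', u₁, u₂, hw₁, hw₂, zero_mul, add_zero, one_mul, sub_zero,
    div_one, add_sub_cancel, hinv_right _ hx₁, hinv_right _ hx₂, hinv_right _ hy₁,
    hinv_right _ hy₂, hφ' _ hx₁, hφ' _ hx₂] at hslope
  rw [div_le_iff₀ hpos]
  simp only [div_eq_mul_inv] at hslope ⊢
  linear_combination hslope

/-- A function of two positive variables that is subadditive as long as the sums do not exceed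
`1` satisfies the corresponding inequality for nonempty finite sums. -/
lemma le_sum_of_subadditive_of_sum_le_one {ι : Type*} {h : ℝ → ℝ → ℝ}
    (hsub : ∀ x₁ x₂ y₁ y₂ : ℝ, 0 < x₁ → 0 < x₂ → 0 < y₁ → 0 < y₂ → x₁ + x₂ ≤ 1 →
      y₁ + y₂ ≤ 1 → h (x₁ + x₂) (y₁ + y₂) ≤ h x₁ y₁ + h x₂ y₂)
    {p q : ι → ℝ} (hp : ∀ i, 0 < p i) (hq : ∀ i, 0 < q i) {S : Finset ι} (hS : S.Nonempty)
    (hpS : ∑ i ∈ S, p i ≤ 1) (hqS : ∑ i ∈ S, q i ≤ 1) :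
    h (∑ i ∈ S, p i) (∑ i ∈ S, q i) ≤ ∑ i ∈ S, h (p i) (q i) := by
  induction hS using Finset.Nonempty.cons_induction with
  | singleton a => simp
  | cons a S ha hS ih =>
    simp only [Finset.sum_cons] at hpS hqS ⊢
    have hstep := hsub _ _ _ _ (hp a) (Finset.sum_pos (fun i _ => hp i) hS) (hq a)
      (Finset.sum_pos (fun i _ => hq i) hS) hpS hqS
    have hrest := ih (by linarith [hp a]) (by linarith [hq a])
    linarith

/-- Sufficiency in Proposition 1: if `g = −(φ⁻¹)'/(φ⁻¹)''` is superadditive on `(0,1)`,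
then the generalized divergence satisfies the partition inequality
`D_φ(p‖q) ≥ D_φ(p^𝒜‖q^𝒜)`. A partition `𝒜 = {A₁,…,A_k}` of `{1,…,n}` is encoded as a
surjective map `A : Fin n → Fin k` (the parts being its fibers). -/
theorem partition_inequality_of_superadditive
    (φ φ' φ'' φinv φinv' φinv'' : ℝ → ℝ)
    -- φ is a strictly positive, strictly increasing deformed exponential
    (hφpos : ∀ u, 0 < φ u)
    (hφconv : ConvexOn ℝ Set.univ φ)
    (hφmono : StrictMono φ)
    (hφbot : Tendsto φ atBot (nhds 0))
    (hφtop : Tendsto φ atTop atTop)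
    -- φ is twice differentiable with φ' > 0
    (hφd : ∀ u, HasDerivAt φ (φ' u) u)
    (hφd2 : ∀ u, HasDerivAt φ' (φ'' u) u)
    (hφ'pos : ∀ u, 0 < φ' u)
    -- φinv is the inverse of φ
    (hinv_left : ∀ u, φinv (φ u) = u)
    (hinv_right : ∀ x : ℝ, 0 < x → φ (φinv x) = x)
    -- φinv is twice differentiable on (0,∞) with (φ⁻¹)' > 0 and (φ⁻¹)'' continuous, < 0
    (hinvd : ∀ x : ℝ, 0 < x → HasDerivAt φinv (φinv' x) x)
    (hinvd2 : ∀ x : ℝ, 0 < x → HasDerivAt φinv' (φinv'' x) x)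
    (hinv'pos : ∀ x : ℝ, 0 < x → 0 < φinv' x)
    (hinv''neg : ∀ x : ℝ, 0 < x → φinv'' x < 0)
    (hinv''cont : ContinuousOn φinv'' (Set.Ioi 0))
    -- g = −(φ⁻¹)'/(φ⁻¹)'' is superadditive on (0,1)
    (g : ℝ → ℝ) (hg : ∀ x, g x = -φinv' x / φinv'' x)
    (hsuper : ∀ x y : ℝ, x ∈ Set.Ioo (0:ℝ) 1 → y ∈ Set.Ioo (0:ℝ) 1 →
      x + y ∈ Set.Ioo (0:ℝ) 1 → g x + g y ≤ g (x + y))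
    -- p, q are probability distributions with strictly positive entries,
    -- and A encodes a partition of {1,…,n}
    (n k : ℕ) (A : Fin n → Fin k) (hA : Function.Surjective A)
    (p q : Fin n → ℝ)
    (hp : ∀ i, 0 < p i) (hq : ∀ i, 0 < q i)
    (hps : ∑ i, p i = 1) (hqs : ∑ i, q i = 1) :
    ∑ j : Fin k,
        (φinv (∑ i ∈ Finset.univ.filter (fun i => A i = j), p i) -
          φinv (∑ i ∈ Finset.univ.filter (fun i => A i = j), q i)) /
          φinv' (∑ i ∈ Finset.univ.filter (fun i => A i = j), p i)
      ≤ ∑ i, (φinv (p i) - φinv (q i)) / φinv' (p i) := by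
  have hgcont : ContinuousOn g (Ioi 0) := by
    have hψ'cont : ContinuousOn φinv' (Ioi 0) := fun x hx =>
      (hinvd2 x hx).continuousAt.continuousWithinAt
    rw [funext hg]
    exact hψ'cont.neg.div hinv''cont fun x hx => (hinv''neg x hx).ne
  have hsub : ∀ x₁ x₂ y₁ y₂ : ℝ, 0 < x₁ → 0 < x₂ → 0 < y₁ → 0 < y₂ → x₁ + x₂ ≤ 1 →
      y₁ + y₂ ≤ 1 → (φinv (x₁ + x₂) - φinv (y₁ + y₂)) / φinv' (x₁ + x₂) ≤
        (φinv x₁ - φinv y₁) / φinv' x₁ + (φinv x₂ - φinv y₂) / φinv' x₂ :=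
    fun _ _ _ _ hx₁ hx₂ hy₁ hy₂ hx hy =>
      divergence_term_subadditive hφpos hφconv hφd hφd2 hinv_left hinv_right hinvd hinvd2
        hinv'pos hinv''neg hg
        (fun _ _ hx hy hxy => superadditive_of_add_le_one hgcont hsuper hx hy hxy)
        hx₁ hx₂ hy₁ hy₂ hx hy
  rw [← Finset.sum_fiberwise Finset.univ A (fun i => (φinv (p i) - φinv (q i)) / φinv' (p i))]
  refine Finset.sum_le_sum fun j _ => ?_
  refine le_sum_of_subadditive_of_sum_le_one
    (h := fun x y => (φinv x - φinv y) / φinv' x) hsub hp hq ?_ ?_ ?_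
  · obtain ⟨i, hi⟩ := hA j
    exact ⟨i, by simp [hi]⟩
  · rw [← hps]
    exact Finset.sum_le_sum_of_subset_of_nonneg (Finset.subset_univ _) fun i _ _ => (hp i).le
  · rw [← hqs]
    exact Finset.sum_le_sum_of_subset_of_nonneg (Finset.subset_univ _) fun i _ _ => (hq i).le
end

section
/- Let φ: ℝ → (0,∞) be a strictly increasing continuous deformed exponential function with inverse φ⁻¹ on (0,∞). Fix α ∈ (0,1) and define F_α(x,y) = φ((1−α) φ⁻¹(x) + α φ⁻¹(y)) for x, y ∈ (0,1), and G(x,y) = φ⁻¹(φ(x) + φ(y)) on the set {(x,y) ∈ ℝ² : φ(x) + φ(y) ∈ (0,1)}. Then F_α is superadditive on (0,1)×(0,1) (meaning F_α(x₁+x₂, y₁+y₂) ≥ F_α(x₁,y₁) + F_α(x₂,y₂) whenever all arguments and the sums x₁+x₂, y₁+y₂ lie in (0,1)) if and only if G is convex on {(x,y) : φ(x) + φ(y) ∈ (0,1)}. -/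
open Filter Set

/-- A continuous function on `[0, 1]` that vanishes at the endpoints and is convex with respect to
one fixed weight `α ∈ (0, 1)` is nonpositive. -/
theorem nonpos_of_fixed_weight_convex {h : ℝ → ℝ} {α : ℝ} (hα : α ∈ Ioo (0 : ℝ) 1)
    (hc : ContinuousOn h (Icc 0 1)) (h0 : h 0 = 0) (h1 : h 1 = 0)
    (hw : ∀ s ∈ Icc (0 : ℝ) 1, ∀ t ∈ Icc (0 : ℝ) 1,
      h ((1 - α) * s + α * t) ≤ (1 - α) * h s + α * h t) :
    ∀ t ∈ Icc (0 : ℝ) 1, h t ≤ 0 := by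
  obtain ⟨hα0, hα1⟩ := hα
  obtain ⟨m, hm, hmax⟩ := isCompact_Icc.exists_isMaxOn ⟨0, by simp⟩ hc
  intro t ht
  by_contra! hpos
  have hM : 0 < h m := hpos.trans_le (hmax ht)
  have hK : IsCompact (Icc (0 : ℝ) 1 ∩ h ⁻¹' {h m}) :=
    isCompact_Icc.of_isClosed_subset
      (hc.preimage_isClosed_of_isClosed isClosed_Icc isClosed_singleton) inter_subset_left
  -- the leftmost maximiser lies strictly inside the interval
  obtain ⟨l, ⟨hl, hlm⟩, hleast⟩ := hK.exists_isLeast ⟨m, hm, rfl⟩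
  have hlm' : h l = h m := hlm
  have hl0 : 0 < l := lt_of_le_of_ne hl.1 (by rintro rfl; linarith)
  have hl1 : l < 1 := lt_of_le_of_ne hl.2 (by rintro rfl; linarith)
  obtain ⟨ε, hε, hεl⟩ : ∃ ε, 0 < ε ∧ ε ≤ min l (1 - l) :=
    ⟨min l (1 - l), lt_min hl0 (by linarith), le_rfl⟩
  have hε1 := hεl.trans (min_le_left _ _)
  have hε2 := hεl.trans (min_le_right _ _)
  have hs : l - α * ε ∈ Icc (0 : ℝ) 1 := ⟨by nlinarith, by nlinarith⟩
  have ht' : l + (1 - α) * ε ∈ Icc (0 : ℝ) 1 := ⟨by nlinarith, by nlinarith⟩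
  have hslt : h (l - α * ε) < h m := by
    refine lt_of_le_of_ne (hmax hs) fun he => ?_
    have := hleast ⟨hs, he⟩
    nlinarith [mul_pos hα0 hε]
  have htle : h (l + (1 - α) * ε) ≤ h m := hmax ht'
  have key := hw _ hs _ ht'
  rw [show (1 - α) * (l - α * ε) + α * (l + (1 - α) * ε) = l by ring, hlm'] at key
  nlinarith

/-- A continuous function on a convex set that is convex with respect to one fixed weight
`α ∈ (0, 1)` is convex. -/
theorem convexOn_of_fixed_weight {E : Type*} [AddCommGroup E] [Module ℝ E] [TopologicalSpace E]
    [ContinuousAdd E] [ContinuousSMul ℝ E] {S : Set E} {f : E → ℝ} {α : ℝ}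
    (hα : α ∈ Ioo (0 : ℝ) 1) (hS : Convex ℝ S) (hf : ContinuousOn f S)
    (hw : ∀ p ∈ S, ∀ q ∈ S, f ((1 - α) • p + α • q) ≤ (1 - α) * f p + α * f q) :
    ConvexOn ℝ S f := by
  refine ⟨hS, fun p hp q hq a b ha hb hab => ?_⟩
  have hmem : ∀ t ∈ Icc (0 : ℝ) 1, (1 - t) • p + t • q ∈ S := fun t ht =>
    hS hp hq (by linarith [ht.2]) ht.1 (by ring)
  have hseg : ContinuousOn (fun t : ℝ => f ((1 - t) • p + t • q)) (Icc 0 1) :=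
    hf.comp (by fun_prop) hmem
  have key := nonpos_of_fixed_weight_convex
    (h := fun t => f ((1 - t) • p + t • q) - ((1 - t) * f p + t * f q)) hα
    (hseg.sub (by fun_prop)) (by simp) (by simp) (fun s hs t ht => by
      have := hw _ (hmem s hs) _ (hmem t ht)
      rw [show (1 - α) • ((1 - s) • p + s • q) + α • ((1 - t) • p + t • q) =
        (1 - ((1 - α) * s + α * t)) • p + ((1 - α) * s + α * t) • q by module] at this
      linarith) b ⟨hb, by linarith⟩
  obtain rfl : a = 1 - b := by linarith
  simpa [sub_nonpos] using key

/-- The inverse on `(0, ∞)` of a strictly increasing bijection from `ℝ` onto `(0, ∞)` is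
continuous there. -/
theorem continuousOn_inverse_of_strictMono {φ φinv : ℝ → ℝ} (hφpos : ∀ u, 0 < φ u)
    (hφmono : StrictMono φ) (hinv_left : ∀ u, φinv (φ u) = u)
    (hinv_right : ∀ x : ℝ, 0 < x → φ (φinv x) = x) : ContinuousOn φinv (Ioi 0) := by
  have hmono : StrictMonoOn φinv (Ioi 0) := fun x hx y hy hxy => by
    rw [← hφmono.lt_iff_lt, hinv_right x hx, hinv_right y hy]
    exact hxy
  have himage : φinv '' Ioi 0 = univ := eq_univ_of_forall fun u => ⟨φ u, hφpos u, hinv_left u⟩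
  intro x hx
  refine (hmono.continuousAt_of_image_mem_nhds (Ioi_mem_nhds hx) ?_).continuousWithinAt
  simp [himage]

/-- Lemma 1: for `α ∈ (0,1)`, the map `F_α(x,y) = φ((1−α)φ⁻¹(x) + αφ⁻¹(y))` is
superadditive on `(0,1)×(0,1)` if and only if `G(x,y) = φ⁻¹(φ(x)+φ(y))` is convex
on `{(x,y) : φ(x)+φ(y) ∈ (0,1)}`. -/
theorem F_alpha_superadditive_iff_G_convex
    (φ φinv : ℝ → ℝ)
    -- φ is a strictly positive, strictly increasing, continuous deformed exponential
    (hφpos : ∀ u, 0 < φ u)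
    (hφconv : ConvexOn ℝ Set.univ φ)
    (hφmono : StrictMono φ)
    (hφcont : Continuous φ)
    (hφbot : Tendsto φ atBot (nhds 0))
    (hφtop : Tendsto φ atTop atTop)
    -- φinv is the inverse of φ on (0,∞)
    (hinv_left : ∀ u, φinv (φ u) = u)
    (hinv_right : ∀ x : ℝ, 0 < x → φ (φinv x) = x)
    (α : ℝ) (hα : α ∈ Set.Ioo (0:ℝ) 1) :
    (∀ x₁ x₂ y₁ y₂ : ℝ, x₁ ∈ Set.Ioo (0:ℝ) 1 → x₂ ∈ Set.Ioo (0:ℝ) 1 →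
      y₁ ∈ Set.Ioo (0:ℝ) 1 → y₂ ∈ Set.Ioo (0:ℝ) 1 →
      x₁ + x₂ ∈ Set.Ioo (0:ℝ) 1 → y₁ + y₂ ∈ Set.Ioo (0:ℝ) 1 →
      φ ((1 - α) * φinv x₁ + α * φinv y₁) + φ ((1 - α) * φinv x₂ + α * φinv y₂) ≤
        φ ((1 - α) * φinv (x₁ + x₂) + α * φinv (y₁ + y₂)))
    ↔ ConvexOn ℝ {xy : ℝ × ℝ | φ xy.1 + φ xy.2 ∈ Set.Ioo (0:ℝ) 1}
        (fun xy : ℝ × ℝ => φinv (φ xy.1 + φ xy.2)) := by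
  have hcontinv := continuousOn_inverse_of_strictMono hφpos hφmono hinv_left hinv_right
  have hsum : ∀ u v, 0 < φ u + φ v := fun u v => add_pos (hφpos u) (hφpos v)
  have hlt : ∀ p ∈ {xy : ℝ × ℝ | φ xy.1 + φ xy.2 ∈ Ioo (0 : ℝ) 1}, φ p.1 < 1 ∧ φ p.2 < 1 :=
    fun p hp => ⟨by linarith [hp.2, hφpos p.2], by linarith [hp.2, hφpos p.1]⟩
  constructor
  · intro H
    have hD : Convex ℝ {xy : ℝ × ℝ | φ xy.1 + φ xy.2 ∈ Ioo (0 : ℝ) 1} := by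
      have hadd : ConvexOn ℝ univ fun xy : ℝ × ℝ => φ xy.1 + φ xy.2 :=
        (hφconv.comp_linearMap (LinearMap.fst ℝ ℝ ℝ)).add
          (hφconv.comp_linearMap (LinearMap.snd ℝ ℝ ℝ))
      simpa [hsum] using hadd.convex_lt 1
    refine convexOn_of_fixed_weight hα hD
      (hcontinv.comp (by fun_prop) fun p _ => hsum p.1 p.2) fun p hp q hq => ?_
    have key := H (φ p.1) (φ p.2) (φ q.1) (φ q.2) ⟨hφpos _, (hlt p hp).1⟩ ⟨hφpos _, (hlt p hp).2⟩
      ⟨hφpos _, (hlt q hq).1⟩ ⟨hφpos _, (hlt q hq).2⟩ hp hq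
    simp only [hinv_left] at key
    rw [← hφmono.le_iff_le, hinv_right _ (hsum _ _)]
    simpa using key
  · rintro ⟨-, H⟩ x₁ x₂ y₁ y₂ hx₁ hx₂ hy₁ hy₂ hx hy
    have key := H (x := (φinv x₁, φinv x₂)) (y := (φinv y₁, φinv y₂))
      (by simpa only [mem_ofPred_eq, hinv_right _ hx₁.1, hinv_right _ hx₂.1] using hx)
      (by simpa only [mem_ofPred_eq, hinv_right _ hy₁.1, hinv_right _ hy₂.1] using hy)
      (sub_nonneg.2 hα.2.le) hα.1.le (sub_add_cancel 1 α)
    rw [← hφmono.le_iff_le, hinv_right _ (hsum _ _)] at key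
    simpa [hinv_right _ hx₁.1, hinv_right _ hx₂.1, hinv_right _ hy₁.1,
      hinv_right _ hy₂.1] using key
end

section
/- Let φ: ℝ → (0,∞) be a strictly increasing deformed exponential function which is twice differentiable with φ' > 0, whose inverse φ⁻¹ on (0,∞) is twice differentiable with (φ⁻¹)' > 0 and (φ⁻¹)'' continuous and strictly negative. Define G(x,y) = φ⁻¹(φ(x) + φ(y)) on the set {(x,y) ∈ ℝ² : φ(x) + φ(y) ∈ (0,1)} and g(x) = −(φ⁻¹)'(x)/(φ⁻¹)''(x) for x ∈ (0,1). Then G is convex on {(x,y) : φ(x) + φ(y) ∈ (0,1)} if and only if g is superadditive on (0,1), i.e., g(x+y) ≥ g(x) + g(y) whenever x, y, x+y ∈ (0,1). -/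
open Filter Set

/-- Second-order characterization of convexity on an open convex set, with `D p v` and `Q p v` the
first and second directional derivatives of `f` at `p` in the direction `v`. -/
theorem convexOn_iff_second_directional_deriv_nonneg {E : Type*} [NormedAddCommGroup E]
    [NormedSpace ℝ E] {S : Set E} (hSo : IsOpen S) (hSc : Convex ℝ S) {f : E → ℝ}
    {D Q : E → E → ℝ}
    (hD : ∀ p v t, p + t • v ∈ S → HasDerivAt (fun t : ℝ => f (p + t • v)) (D (p + t • v) v) t)
    (hQ : ∀ p v t, p + t • v ∈ S →
      HasDerivAt (fun t : ℝ => D (p + t • v) v) (Q (p + t • v) v) t) :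
    ConvexOn ℝ S f ↔ ∀ p ∈ S, ∀ v, 0 ≤ Q p v := by
  constructor
  · intro hf p hp v
    set T : Set ℝ := (fun t : ℝ => p + t • v) ⁻¹' S with hT
    have hTo : IsOpen T := hSo.preimage (by fun_prop)
    have h0 : (0 : ℝ) ∈ T := by simpa [hT] using hp
    have hcomp : ConvexOn ℝ T (fun t : ℝ => f (p + t • v)) := by
      have h := hf.comp_affineMap (AffineMap.lineMap p (p + v) : ℝ →ᵃ[ℝ] E)
      have he : ((AffineMap.lineMap p (p + v) : ℝ →ᵃ[ℝ] E) : ℝ → E) = fun t => p + t • v := by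
        ext t
        simp [AffineMap.lineMap_apply, add_comm]
      rw [he] at h
      exact h
    have hmono : MonotoneOn (fun t : ℝ => D (p + t • v) v) T :=
      (hcomp.monotoneOn_deriv fun t ht => (hD p v t ht).differentiableAt).congr
        fun t ht => (hD p v t ht).deriv
    have hder := (hQ p v 0 h0).hasDerivWithinAt (s := T) |>.derivWithin
      (hTo.uniqueDiffWithinAt h0)
    have hnonneg : 0 ≤ derivWithin (fun t : ℝ => D (p + t • v) v) T 0 := hmono.derivWithin_nonneg
    rw [hder] at hnonneg
    simpa using hnonneg
  · intro h
    refine ⟨hSc, fun p hp q hq a b ha hb hab => ?_⟩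
    have hmem : ∀ t ∈ Icc (0 : ℝ) 1, p + t • (q - p) ∈ S := fun t ht =>
      hSc.add_smul_sub_mem hp hq ht
    have hconv : ConvexOn ℝ (Icc (0 : ℝ) 1) (fun t : ℝ => f (p + t • (q - p))) := by
      refine convexOn_of_hasDerivWithinAt2_nonneg (convex_Icc 0 1)
        (f' := fun t => D (p + t • (q - p)) (q - p)) (f'' := fun t => Q (p + t • (q - p)) (q - p))
        (fun t ht => (hD p _ t (hmem t ht)).continuousAt.continuousWithinAt)
        (fun t ht => (hD p _ t (hmem t (interior_subset ht))).hasDerivWithinAt)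
        (fun t ht => (hQ p _ t (hmem t (interior_subset ht))).hasDerivWithinAt)
        (fun t ht => h _ (hmem t (interior_subset ht)) _)
    have key := hconv.2 (left_mem_Icc.2 zero_le_one) (right_mem_Icc.2 zero_le_one) ha hb hab
    have hpt : p + b • (q - p) = a • p + b • q := by
      obtain rfl : a = 1 - b := by linarith
      module
    simpa [hpt] using key

/-- The form `P² / a + Q² / b - (P + Q)² / c` is positive semidefinite iff `a + b ≤ c`. -/
theorem forall_add_sq_div_le_iff {a b c : ℝ} (ha : 0 < a) (hb : 0 < b) (hc : 0 < c) :
    (∀ P Q : ℝ, (P + Q) ^ 2 / c ≤ P ^ 2 / a + Q ^ 2 / b) ↔ a + b ≤ c := by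
  constructor
  · intro h
    have h1 := h a b
    have h2 : a ^ 2 / a + b ^ 2 / b = a + b := by field_simp
    rw [h2, div_le_iff₀ hc] at h1
    have hab : 0 < a + b := by positivity
    nlinarith
  · intro h P Q
    calc (P + Q) ^ 2 / c ≤ (P + Q) ^ 2 / (a + b) := by gcongr
      _ ≤ P ^ 2 / a + Q ^ 2 / b := by
        rw [div_add_div _ _ ha.ne' hb.ne', div_le_div_iff₀ (by positivity) (by positivity)]
        nlinarith [sq_nonneg (P * b - Q * a)]

/-- Lemma 2: `G(x,y) = φ⁻¹(φ(x)+φ(y))` is convex on `{(x,y) : φ(x)+φ(y) ∈ (0,1)}`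
if and only if `g = −(φ⁻¹)'/(φ⁻¹)''` is superadditive on `(0,1)`. -/
theorem G_convex_iff_g_superadditive
    (φ φ' φ'' φinv φinv' φinv'' : ℝ → ℝ)
    -- φ is a strictly positive, strictly increasing deformed exponential
    (hφpos : ∀ u, 0 < φ u)
    (hφconv : ConvexOn ℝ Set.univ φ)
    (hφmono : StrictMono φ)
    (hφbot : Tendsto φ atBot (nhds 0))
    (hφtop : Tendsto φ atTop atTop)
    -- φ is twice differentiable with φ' > 0
    (hφd : ∀ u, HasDerivAt φ (φ' u) u)
    (hφd2 : ∀ u, HasDerivAt φ' (φ'' u) u)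
    (hφ'pos : ∀ u, 0 < φ' u)
    -- φinv is the inverse of φ
    (hinv_left : ∀ u, φinv (φ u) = u)
    (hinv_right : ∀ x : ℝ, 0 < x → φ (φinv x) = x)
    -- φinv is twice differentiable on (0,∞) with (φ⁻¹)' > 0 and (φ⁻¹)'' continuous, < 0
    (hinvd : ∀ x : ℝ, 0 < x → HasDerivAt φinv (φinv' x) x)
    (hinvd2 : ∀ x : ℝ, 0 < x → HasDerivAt φinv' (φinv'' x) x)
    (hinv'pos : ∀ x : ℝ, 0 < x → 0 < φinv' x)
    (hinv''neg : ∀ x : ℝ, 0 < x → φinv'' x < 0)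
    (hinv''cont : ContinuousOn φinv'' (Set.Ioi 0))
    (g : ℝ → ℝ) (hg : ∀ x, g x = -φinv' x / φinv'' x) :
    ConvexOn ℝ {xy : ℝ × ℝ | φ xy.1 + φ xy.2 ∈ Set.Ioo (0:ℝ) 1}
        (fun xy : ℝ × ℝ => φinv (φ xy.1 + φ xy.2))
    ↔ ∀ x y : ℝ, x ∈ Set.Ioo (0:ℝ) 1 → y ∈ Set.Ioo (0:ℝ) 1 →
        x + y ∈ Set.Ioo (0:ℝ) 1 → g x + g y ≤ g (x + y) := by
  have hspos : ∀ p : ℝ × ℝ, 0 < φ p.1 + φ p.2 := fun p => add_pos (hφpos _) (hφpos _)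
  have hgpos : ∀ x, 0 < x → 0 < g x := fun x hx => by
    rw [hg, neg_div, ← div_neg]
    exact div_pos (hinv'pos x hx) (neg_pos.2 (hinv''neg x hx))
  have hcont : Continuous φ := continuous_iff_continuousAt.2 fun u => (hφd u).continuousAt
  have hprod : ∀ u, φinv' (φ u) * φ' u = 1 := fun u => by
    have h := (hinvd (φ u) (hφpos u)).comp u (hφd u)
    have he : φinv ∘ φ = id := funext hinv_left
    rw [he] at h
    exact h.unique (hasDerivAt_id u)
  -- the second derivative of `φ` expressed through `g`
  have hφ'' : ∀ u, φ'' u = φ' u ^ 2 / g (φ u) := fun u => by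
    have h := ((hinvd2 (φ u) (hφpos u)).comp u (hφd u)).mul (hφd2 u)
    have he : (φinv' ∘ φ) * φ' = fun _ => (1 : ℝ) := funext hprod
    rw [he] at h
    have h0 := h.unique (hasDerivAt_const u (1 : ℝ))
    have h1 := (hinv'pos (φ u) (hφpos u)).ne'
    have h2 := (hinv''neg (φ u) (hφpos u)).ne
    simp only [Function.comp_apply] at h0
    rw [hg]
    field_simp
    linear_combination h0
  set S : Set (ℝ × ℝ) := {xy | φ xy.1 + φ xy.2 ∈ Ioo (0 : ℝ) 1} with hS
  have hSo : IsOpen S := isOpen_Ioo.preimage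
    (f := fun xy : ℝ × ℝ => φ xy.1 + φ xy.2) (by fun_prop)
  have hSc : Convex ℝ S := by
    have h := ((hφconv.comp_linearMap (LinearMap.fst ℝ ℝ ℝ)).add
      (hφconv.comp_linearMap (LinearMap.snd ℝ ℝ ℝ))).convex_lt 1
    refine (congrArg (Convex ℝ) (Set.ext fun p => ?_)).mp h
    simp [hS, hspos p]
  have hline : ∀ (p v : ℝ × ℝ) (t : ℝ),
      HasDerivAt (fun t : ℝ => (p + t • v).1) v.1 t ∧
      HasDerivAt (fun t : ℝ => (p + t • v).2) v.2 t := fun p v t => by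
    constructor
    · simpa using ((hasDerivAt_id t).mul_const v.1).const_add p.1
    · simpa using ((hasDerivAt_id t).mul_const v.2).const_add p.2
  have hsum : ∀ (p v : ℝ × ℝ) (t : ℝ),
      HasDerivAt (fun t : ℝ => φ (p + t • v).1 + φ (p + t • v).2)
        (φ' (p + t • v).1 * v.1 + φ' (p + t • v).2 * v.2) t := fun p v t =>
    ((hφd _).comp t (hline p v t).1).add ((hφd _).comp t (hline p v t).2)
  rw [convexOn_iff_second_directional_deriv_nonneg hSo hSc
    (D := fun p v => φinv' (φ p.1 + φ p.2) * (φ' p.1 * v.1 + φ' p.2 * v.2))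
    (Q := fun p v => φinv' (φ p.1 + φ p.2) * ((φ' p.1 * v.1) ^ 2 / g (φ p.1)
      + (φ' p.2 * v.2) ^ 2 / g (φ p.2)
      - (φ' p.1 * v.1 + φ' p.2 * v.2) ^ 2 / g (φ p.1 + φ p.2)))
    (fun p v t _ => (hinvd _ (hspos _)).comp t (hsum p v t)) ?_]
  · have hiff : ∀ p : ℝ × ℝ,
        (∀ v : ℝ × ℝ, 0 ≤ φinv' (φ p.1 + φ p.2) * ((φ' p.1 * v.1) ^ 2 / g (φ p.1)
          + (φ' p.2 * v.2) ^ 2 / g (φ p.2)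
          - (φ' p.1 * v.1 + φ' p.2 * v.2) ^ 2 / g (φ p.1 + φ p.2))) ↔
        g (φ p.1) + g (φ p.2) ≤ g (φ p.1 + φ p.2) := fun p => by
      simp only [mul_nonneg_iff_of_pos_left (hinv'pos _ (hspos p)), sub_nonneg]
      rw [← forall_add_sq_div_le_iff (hgpos _ (hφpos _)) (hgpos _ (hφpos _)) (hgpos _ (hspos p))]
      constructor
      · intro h P R
        have := h (P / φ' p.1, R / φ' p.2)
        simpa only [mul_div_cancel₀ _ (hφ'pos _).ne'] using this
      · exact fun h v => h _ _
    simp only [hiff]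
    constructor
    · intro h x y hx hy hxy
      have := h (φinv x, φinv y) (by simpa [hS, hinv_right x hx.1, hinv_right y hy.1] using hxy)
      simpa only [hinv_right x hx.1, hinv_right y hy.1] using this
    · intro h p hp
      have h1 := hφpos p.1
      have h2 := hφpos p.2
      have h3 : φ p.1 + φ p.2 < 1 := hp.2
      exact h _ _ ⟨h1, by linarith⟩ ⟨h2, by linarith⟩ hp
  · intro p v t _
    have h := ((hinvd2 _ (hspos (p + t • v))).comp t (hsum p v t)).mul
      ((((hφd2 _).comp t (hline p v t).1).mul_const v.1).add
        (((hφd2 _).comp t (hline p v t).2).mul_const v.2))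
    refine h.congr_deriv ?_
    have h1 := (hinv'pos _ (hspos (p + t • v))).ne'
    have h2 := (hinv''neg _ (hspos (p + t • v))).ne
    have h3 := (hgpos _ (hφpos (p + t • v).1)).ne'
    have h4 := (hgpos _ (hφpos (p + t • v).2)).ne'
    simp only [Function.comp_apply, Pi.add_apply, hφ'', hg (φ (p + t • v).1 + φ (p + t • v).2)]
    field_simp
    ring
end

section
/- Let φ: ℝ → (0,∞) be a strictly increasing deformed exponential function which is twice differentiable with φ' > 0 and φ'' > 0, whose inverse φ⁻¹ is twice differentiable with (φ⁻¹)' > 0 and (φ⁻¹)'' < 0, and set g(x) = −(φ⁻¹)'(x)/(φ⁻¹)''(x). Then g is concave on (0,∞) if and only if for each α ∈ (0,1) the mapping F_α(x,y) = φ((1−α) φ⁻¹(x) + α φ⁻¹(y)) is concave on (0,∞)×(0,∞). -/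
open Filter Set

/-- Comparison of increments of two functions on `[a, b]` through their derivatives. -/
theorem sub_le_sub_of_hasDerivAt_le {f p f' p' : ℝ → ℝ} {a b : ℝ} (hab : a ≤ b)
    (hf : ∀ t ∈ Icc a b, HasDerivAt f (f' t) t) (hp : ∀ t ∈ Icc a b, HasDerivAt p (p' t) t)
    (hle : ∀ t ∈ Icc a b, f' t ≤ p' t) : f b - f a ≤ p b - p a := by
  have hd : ∀ t ∈ Icc a b, HasDerivAt (fun t => p t - f t) (p' t - f' t) t :=
    fun t ht => (hp t ht).sub (hf t ht)
  have hmono : MonotoneOn (fun t => p t - f t) (Icc a b) :=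
    monotoneOn_of_hasDerivWithinAt_nonneg (convex_Icc a b)
      (fun t ht => (hd t ht).continuousAt.continuousWithinAt)
      (fun t ht => (hd t (interior_subset ht)).hasDerivWithinAt)
      (fun t ht => sub_nonneg.2 (hle t (interior_subset ht)))
  have h := hmono (left_mem_Icc.2 hab) (right_mem_Icc.2 hab) hab
  simp only at h
  linarith

/-- A concave function lies above its chord between the endpoints. -/
theorem ConcaveOn.chord_le {S : Set ℝ} {f : ℝ → ℝ} (hf : ConcaveOn ℝ S f) {a b x : ℝ}
    (ha : a ∈ S) (hb : b ∈ S) (hab : a < b) (hx : x ∈ Icc a b) :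
    f a + (f b - f a) / (b - a) * (x - a) ≤ f x := by
  rcases hx.1.eq_or_lt with rfl | hax
  · simp
  rcases hx.2.eq_or_lt with rfl | hxb
  · rw [div_mul_cancel₀ _ (sub_pos.2 hax).ne']; linarith
  have h := hf.slope_anti_adjacent ha hb hax hxb
  have h1 := sub_pos.2 hax
  have h2 := sub_pos.2 hxb
  have h3 := sub_pos.2 hab
  rw [div_le_div_iff₀ h2 h1] at h
  have : (f b - f a) / (b - a) * (x - a) ≤ f x - f a := by
    rw [div_mul_eq_mul_div, div_le_iff₀ h3]
    linarith
  linarith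

/-- A concave function lies below the extension of a chord to the right. -/
theorem ConcaveOn.le_chord_right {S : Set ℝ} {f : ℝ → ℝ} (hf : ConcaveOn ℝ S f) {a b x : ℝ}
    (ha : a ∈ S) (hx : x ∈ S) (hab : a < b) (hbx : b ≤ x) :
    f x ≤ f a + (f b - f a) / (b - a) * (x - a) := by
  have h3 := sub_pos.2 hab
  rcases hbx.eq_or_lt with rfl | hbx
  · rw [div_mul_cancel₀ _ h3.ne']; linarith
  have h := hf.slope_anti_adjacent ha hx hab hbx
  rw [div_le_iff₀ (sub_pos.2 hbx)] at h
  have h4 : (f b - f a) / (b - a) * (b - a) = f b - f a := div_mul_cancel₀ _ h3.ne'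
  linear_combination h - h4

/-- A concave function lies below the extension of a chord to the left. -/
theorem ConcaveOn.le_chord_left {S : Set ℝ} {f : ℝ → ℝ} (hf : ConcaveOn ℝ S f) {a b x : ℝ}
    (hb : b ∈ S) (hx : x ∈ S) (hab : a < b) (hxa : x ≤ a) :
    f x ≤ f a + (f b - f a) / (b - a) * (x - a) := by
  rcases hxa.eq_or_lt with rfl | hxa
  · simp
  have h := hf.slope_anti_adjacent hx hb hxa hab
  rw [le_div_iff₀ (sub_pos.2 hxa)] at h
  linarith

/-- If `g` is concave and `g ∘ φ = φ'² / φ''`, then `φ' / φ''` is concave. -/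
theorem concaveOn_deriv_div_deriv2 {φ φ' φ'' g : ℝ → ℝ}
    (hφpos : ∀ u, 0 < φ u) (hφmono : StrictMono φ)
    (hφd : ∀ u, HasDerivAt φ (φ' u) u) (hφd2 : ∀ u, HasDerivAt φ' (φ'' u) u)
    (hφ'pos : ∀ u, 0 < φ' u) (hφ''pos : ∀ u, 0 < φ'' u)
    (hgφ : ∀ u, g (φ u) = φ' u ^ 2 / φ'' u) (hg : ConcaveOn ℝ (Ioi 0) g) :
    ConcaveOn ℝ univ (fun u => φ' u / φ'' u) := by
  have hgs : ∀ u, g (φ u) / φ' u = φ' u / φ'' u := fun u => by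
    have := (hφ'pos u).ne'
    have := (hφ''pos u).ne'
    rw [hgφ]; field_simp
  refine concaveOn_of_slope_anti_adjacent convex_univ ?_
  intro a b c _ _ hab hbc
  have hφab := sub_pos.2 (hφmono hab)
  set m := (g (φ b) - g (φ a)) / (φ b - φ a)
  have hmb : m * (φ b - φ a) = g (φ b) - g (φ a) := div_mul_cancel₀ _ hφab.ne'
  set L : ℝ → ℝ := fun u => g (φ a) + m * (φ u - φ a) with hL
  have hLa : L a / φ' a = φ' a / φ'' a := by rw [← hgs]; simp [hL]
  have hLb : L b / φ' b = φ' b / φ'' b := by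
    rw [← hgs]; simp only [hL, hmb]; ring
  have hd : ∀ u, HasDerivAt (fun u => L u / φ' u) (m - L u * φ'' u / φ' u ^ 2) u := fun u => by
    have h := ((((hφd u).sub_const (φ a)).const_mul m).const_add (g (φ a))).div (hφd2 u)
      (hφ'pos u).ne'
    refine h.congr_deriv ?_
    have := (hφ'pos u).ne'
    simp only [hL]
    field_simp
  have hlin : ∀ u, HasDerivAt (fun u => (m - 1) * u) (m - 1) u := fun u => by
    simpa using (hasDerivAt_id u).const_mul (m - 1)
  have hinside := sub_le_sub_of_hasDerivAt_le hab.le (fun u _ => hlin u) (fun u _ => hd u)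
    (fun u hu => by
      have h := hg.chord_le (hφpos a) (hφpos b) (hφmono hab)
        ⟨hφmono.monotone hu.1, hφmono.monotone hu.2⟩
      have h' : L u ≤ φ' u ^ 2 / φ'' u := by rw [← hgφ]; exact h
      rw [le_div_iff₀ (hφ''pos u)] at h'
      have : L u * φ'' u / φ' u ^ 2 ≤ 1 := (div_le_one (pow_pos (hφ'pos u) 2)).2 h'
      linarith)
  have houtside : ∀ u, b ≤ u → φ' u ^ 2 / φ'' u ≤ L u := fun u hu => by
    rw [← hgφ]
    exact hg.le_chord_right (hφpos a) (hφpos u) (hφmono hab) (hφmono.monotone hu)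
  have hright := sub_le_sub_of_hasDerivAt_le hbc.le (fun u _ => hd u) (fun u _ => hlin u)
    (fun u hu => by
      have h' := houtside u hu.1
      rw [div_le_iff₀ (hφ''pos u)] at h'
      have : 1 ≤ L u * φ'' u / φ' u ^ 2 := (one_le_div (pow_pos (hφ'pos u) 2)).2 h'
      linarith)
  have hc : φ' c / φ'' c ≤ L c / φ' c := by
    rw [← hgs, hgφ]
    exact div_le_div_of_nonneg_right (houtside c hbc.le) (hφ'pos c).le
  simp only [hLa, hLb] at hinside hright
  calc (φ' c / φ'' c - φ' b / φ'' b) / (c - b) ≤ m - 1 := by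
        rw [div_le_iff₀ (sub_pos.2 hbc)]; linarith
    _ ≤ (φ' b / φ'' b - φ' a / φ'' a) / (b - a) := by
        rw [le_div_iff₀ (sub_pos.2 hab)]; linarith

/-- If `φ' / φ''` is concave and `g ∘ φ = φ'² / φ''`, then `g` is concave. -/
theorem concaveOn_of_concaveOn_deriv_div_deriv2 {φ φ' φ'' g : ℝ → ℝ}
    (hφmono : StrictMono φ) (hφsurj : ∀ x, 0 < x → ∃ u, φ u = x)
    (hφd : ∀ u, HasDerivAt φ (φ' u) u) (hφd2 : ∀ u, HasDerivAt φ' (φ'' u) u)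
    (hφ'pos : ∀ u, 0 < φ' u) (hφ''pos : ∀ u, 0 < φ'' u)
    (hgφ : ∀ u, g (φ u) = φ' u ^ 2 / φ'' u)
    (hs : ConcaveOn ℝ univ (fun u => φ' u / φ'' u)) :
    ConcaveOn ℝ (Ioi 0) g := by
  have hgs : ∀ u, g (φ u) = φ' u * (φ' u / φ'' u) := fun u => by rw [hgφ]; ring
  refine concaveOn_of_slope_anti_adjacent (convex_Ioi 0) ?_
  intro x y z hx hz hxy hyz
  obtain ⟨a, rfl⟩ := hφsurj x hx
  obtain ⟨b, rfl⟩ := hφsurj y (lt_trans hx hxy)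
  obtain ⟨c, rfl⟩ := hφsurj z hz
  have hab := hφmono.lt_iff_lt.1 hxy
  have hbc := hφmono.lt_iff_lt.1 hyz
  set k := (φ' c / φ'' c - φ' b / φ'' b) / (c - b)
  have hkc : k * (c - b) = φ' c / φ'' c - φ' b / φ'' b :=
    div_mul_cancel₀ _ (sub_pos.2 hbc).ne'
  set l : ℝ → ℝ := fun u => φ' b / φ'' b + k * (u - b) with hl
  have hlb : φ' b * l b = g (φ b) := by rw [hgs]; simp [hl]
  have hlc : φ' c * l c = g (φ c) := by rw [hgs]; simp only [hl, hkc]; ring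
  have hd : ∀ u, HasDerivAt (fun u => φ' u * l u) (φ'' u * l u + φ' u * k) u := fun u => by
    have h := (hφd2 u).mul
      ((((hasDerivAt_id u).sub_const b).const_mul k).const_add (φ' b / φ'' b))
    exact h.congr_deriv (by simp [hl])
  have hlin : ∀ u, HasDerivAt (fun u => (1 + k) * φ u) ((1 + k) * φ' u) u :=
    fun u => (hφd u).const_mul (1 + k)
  have hinside := sub_le_sub_of_hasDerivAt_le hbc.le (fun u _ => hd u) (fun u _ => hlin u)
    (fun u hu => by
      have h : l u ≤ φ' u / φ'' u := hs.chord_le (mem_univ b) (mem_univ c) hbc hu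
      rw [le_div_iff₀ (hφ''pos u)] at h
      linarith)
  have houtside : ∀ u, u ≤ b → φ' u / φ'' u ≤ l u := fun u hu =>
    hs.le_chord_left (mem_univ c) (mem_univ u) hbc hu
  have hleft := sub_le_sub_of_hasDerivAt_le hab.le (fun u _ => hlin u) (fun u _ => hd u)
    (fun u hu => by
      have h := houtside u hu.2
      rw [div_le_iff₀ (hφ''pos u)] at h
      linarith)
  have ha : g (φ a) ≤ φ' a * l a := by
    rw [hgs]
    exact mul_le_mul_of_nonneg_left (houtside a hab.le) (hφ'pos a).le
  simp only [hlb, hlc] at hinside hleft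
  calc (g (φ c) - g (φ b)) / (φ c - φ b) ≤ 1 + k := by
        rw [div_le_iff₀ (sub_pos.2 hyz)]; linarith
    _ ≤ (g (φ b) - g (φ a)) / (φ b - φ a) := by
        rw [le_div_iff₀ (sub_pos.2 hxy)]; linarith

/-- A function is concave on a convex set if its restrictions to all lines are concave. -/
theorem concaveOn_of_comp_lineMap {E : Type*} [AddCommGroup E] [Module ℝ E] {s : Set E}
    {F : E → ℝ} (hs : Convex ℝ s)
    (h : ∀ p ∈ s, ∀ q ∈ s, ConcaveOn ℝ (AffineMap.lineMap p q ⁻¹' s : Set ℝ)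
      (fun t : ℝ => F (AffineMap.lineMap p q t))) : ConcaveOn ℝ s F := by
  refine ⟨hs, fun p hp q hq a b ha hb hab => ?_⟩
  have h01 := (h p hp q hq).2 (x := 0) (by simpa using hp) (y := 1) (by simpa using hq) ha hb hab
  have hmap : AffineMap.lineMap p q b = a • p + b • q := by
    rw [AffineMap.lineMap_apply_module, ← hab, add_sub_cancel_right]
  simpa [hmap] using h01

/-- The second derivative of a concave function is nonpositive. -/
theorem ConcaveOn.hasDerivAt2_nonpos {S : Set ℝ} {f f' : ℝ → ℝ} {c t₀ : ℝ}
    (hf : ConcaveOn ℝ S f) (hS : S ∈ nhds t₀) (hd : ∀ t ∈ S, HasDerivAt f (f' t) t)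
    (hd2 : HasDerivAt f' c t₀) : c ≤ 0 := by
  have hanti : AntitoneOn f' S :=
    (hf.antitoneOn_deriv fun t ht => (hd t ht).differentiableAt).congr
      fun t ht => (hd t ht).deriv
  rw [← hd2.hasDerivWithinAt.derivWithin (uniqueDiffWithinAt_of_mem_nhds hS)]
  exact hanti.derivWithin_nonpos

/-- Weighted Cauchy–Schwarz inequality in the form used for the Hessian of `F_α`. -/
theorem sq_add_le_weighted {α a b s t : ℝ} (hα : 0 ≤ α) (hα1 : α ≤ 1) (hs : 0 < s) (ht : 0 < t) :
    ((1 - α) * a + α * b) ^ 2 ≤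
      ((1 - α) * s + α * t) * ((1 - α) * (a ^ 2 / s) + α * (b ^ 2 / t)) := by
  have key : ((1 - α) * s + α * t) * ((1 - α) * (a ^ 2 / s) + α * (b ^ 2 / t)) -
      ((1 - α) * a + α * b) ^ 2 = (1 - α) * α * ((t * a - s * b) ^ 2 / (s * t)) := by
    field_simp
    ring
  have : 0 ≤ (1 - α) * α * ((t * a - s * b) ^ 2 / (s * t)) := by
    have := sub_nonneg.2 hα1
    positivity
  linarith

/-- The quasi-arithmetic mean `φ ((1 - α) φ⁻¹ x + α φ⁻¹ y)` is jointly concave for every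
`α ∈ (0, 1)` if and only if `φ' / φ''` is concave. -/
theorem forall_concaveOn_interpolation_iff {φ φ' φ'' ψ ψ' ψ'' : ℝ → ℝ}
    (hφpos : ∀ u, 0 < φ u)
    (hφd : ∀ u, HasDerivAt φ (φ' u) u) (hφd2 : ∀ u, HasDerivAt φ' (φ'' u) u)
    (hφ'pos : ∀ u, 0 < φ' u) (hφ''pos : ∀ u, 0 < φ'' u)
    (hψφ : ∀ u, ψ (φ u) = u) (hφψ : ∀ x, 0 < x → φ (ψ x) = x)
    (hψd : ∀ x, 0 < x → HasDerivAt ψ (ψ' x) x) (hψd2 : ∀ x, 0 < x → HasDerivAt ψ' (ψ'' x) x)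
    (hψ' : ∀ u, ψ' (φ u) = 1 / φ' u) (hψ'' : ∀ u, ψ'' (φ u) = -φ'' u / φ' u ^ 3) :
    (∀ α ∈ Ioo (0 : ℝ) 1, ConcaveOn ℝ (Ioi (0 : ℝ) ×ˢ Ioi (0 : ℝ))
      (fun xy : ℝ × ℝ => φ ((1 - α) * ψ xy.1 + α * ψ xy.2))) ↔
    ConcaveOn ℝ univ (fun u => φ' u / φ'' u) := by
  have hspos : ∀ u, 0 < φ' u / φ'' u := fun u => div_pos (hφ'pos u) (hφ''pos u)
  have hline : ∀ x h t : ℝ, HasDerivAt (fun t => x + t * h) h t := fun x h t => by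
    simpa using ((hasDerivAt_id t).mul_const h).const_add x
  -- first and second derivatives along a line
  set W : ℝ → ℝ → ℝ → ℝ → ℝ → ℝ → ℝ := fun α x h y k t =>
    (1 - α) * ψ (x + t * h) + α * ψ (y + t * k) with hW
  set W' : ℝ → ℝ → ℝ → ℝ → ℝ → ℝ → ℝ := fun α x h y k t =>
    (1 - α) * (ψ' (x + t * h) * h) + α * (ψ' (y + t * k) * k) with hW'
  set W'' : ℝ → ℝ → ℝ → ℝ → ℝ → ℝ → ℝ := fun α x h y k t =>
    (1 - α) * (ψ'' (x + t * h) * h * h) + α * (ψ'' (y + t * k) * k * k) with hW''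
  have hWd : ∀ α x h y k t, 0 < x + t * h → 0 < y + t * k →
      HasDerivAt (W α x h y k) (W' α x h y k t) t := fun α x h y k t hx hy =>
    (((hψd _ hx).comp t (hline x h t)).const_mul (1 - α)).add
      (((hψd _ hy).comp t (hline y k t)).const_mul α)
  have hW'd : ∀ α x h y k t, 0 < x + t * h → 0 < y + t * k →
      HasDerivAt (W' α x h y k) (W'' α x h y k t) t := fun α x h y k t hx hy =>
    ((((hψd2 _ hx).comp t (hline x h t)).mul_const h).const_mul (1 - α)).add
      ((((hψd2 _ hy).comp t (hline y k t)).mul_const k).const_mul α)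
  have hFd : ∀ α x h y k t, 0 < x + t * h → 0 < y + t * k →
      HasDerivAt (fun t => φ (W α x h y k t)) (φ' (W α x h y k t) * W' α x h y k t) t :=
    fun α x h y k t hx hy => (hφd _).comp t (hWd α x h y k t hx hy)
  have hF'd : ∀ α x h y k t, 0 < x + t * h → 0 < y + t * k →
      HasDerivAt (fun t => φ' (W α x h y k t) * W' α x h y k t)
        (φ'' (W α x h y k t) * W' α x h y k t * W' α x h y k t +
          φ' (W α x h y k t) * W'' α x h y k t) t :=
    fun α x h y k t hx hy =>
      ((hφd2 _).comp t (hWd α x h y k t hx hy)).mul (hW'd α x h y k t hx hy)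
  have hlm : ∀ (p q : ℝ × ℝ) (t : ℝ), AffineMap.lineMap p q t =
      (p.1 + t * (q.1 - p.1), p.2 + t * (q.2 - p.2)) := fun p q t => by
    rw [AffineMap.lineMap_apply_module']
    ext <;> simp [add_comm]
  have hopen : ∀ p q : ℝ × ℝ,
      IsOpen (AffineMap.lineMap p q ⁻¹' (Ioi (0 : ℝ) ×ˢ Ioi (0 : ℝ)) : Set ℝ) := fun p q =>
    (isOpen_Ioi.prod isOpen_Ioi).preimage AffineMap.lineMap_continuous
  have hmem : ∀ (p q : ℝ × ℝ) (t : ℝ),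
      t ∈ (AffineMap.lineMap p q ⁻¹' (Ioi (0 : ℝ) ×ˢ Ioi (0 : ℝ)) : Set ℝ) →
      0 < p.1 + t * (q.1 - p.1) ∧ 0 < p.2 + t * (q.2 - p.2) := fun p q t ht => by
    rw [mem_preimage, hlm] at ht
    exact ht
  constructor
  · intro hF
    rw [concaveOn_iff_forall_pos]
    refine ⟨convex_univ, fun u _ v _ β α hβ hα hβα => ?_⟩
    obtain rfl : β = 1 - α := by linarith
    set h := φ' u * (φ' u / φ'' u) with hh
    set k := φ' v * (φ' v / φ'' v) with hk
    set p : ℝ × ℝ := (φ u, φ v) with hp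
    set q : ℝ × ℝ := (φ u + h, φ v + k) with hq
    have hconc := (hF α ⟨hα, by linarith⟩).comp_affineMap (AffineMap.lineMap p q)
    have hS : (AffineMap.lineMap p q ⁻¹' (Ioi (0 : ℝ) ×ˢ Ioi (0 : ℝ)) : Set ℝ) ∈ nhds 0 :=
      (hopen p q).mem_nhds (by simp [hp, hφpos])
    have hnonpos := hconc.hasDerivAt2_nonpos
      (f' := fun t => φ' (W α (φ u) h (φ v) k t) * W' α (φ u) h (φ v) k t) hS
      (fun t ht => by
        have ht' := hmem p q t ht
        simp only [hp, hq, add_sub_cancel_left] at ht'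
        convert hFd α (φ u) h (φ v) k t ht'.1 ht'.2 using 1
        funext t
        simp [hlm, hp, hq, hW])
      (hF'd α (φ u) h (φ v) k 0 (by simpa using hφpos u) (by simpa using hφpos v))
    have hu := (hφ'pos u).ne'
    have hv := (hφ'pos v).ne'
    have hu2 := (hφ''pos u).ne'
    have hv2 := (hφ''pos v).ne'
    set S := (1 - α) * (φ' u / φ'' u) + α * (φ' v / φ'' v) with hSdef
    have hSpos : 0 < S := add_pos (mul_pos hβ (hspos u)) (mul_pos hα (hspos v))
    have e0 : W α (φ u) h (φ v) k 0 = (1 - α) * u + α * v := by simp [hW, hψφ]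
    have e1 : W' α (φ u) h (φ v) k 0 = S := by
      simp only [hW', zero_mul, add_zero, hψ', hh, hk, hSdef]
      field_simp
    have e2 : W'' α (φ u) h (φ v) k 0 = -S := by
      simp only [hW'', zero_mul, add_zero, hψ'', hh, hk, hSdef]
      field_simp
      ring
    rw [e0, e1, e2] at hnonpos
    simp only [smul_eq_mul]
    rw [← hSdef, le_div_iff₀ (hφ''pos _)]
    refine le_of_mul_le_mul_right ?_ hSpos
    linarith
  · intro hs α hα
    refine concaveOn_of_comp_lineMap ((convex_Ioi 0).prod (convex_Ioi 0)) fun p _ q _ => ?_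
    set h := q.1 - p.1
    set k := q.2 - p.2
    have hconv : Convex ℝ (AffineMap.lineMap p q ⁻¹' (Ioi (0 : ℝ) ×ˢ Ioi (0 : ℝ)) : Set ℝ) :=
      ((convex_Ioi 0).prod (convex_Ioi 0)).affine_preimage (AffineMap.lineMap p q)
    have hfun : (fun t : ℝ => φ ((1 - α) * ψ (AffineMap.lineMap p q t).1 +
        α * ψ (AffineMap.lineMap p q t).2)) = fun t => φ (W α p.1 h p.2 k t) := by
      funext t
      rw [hlm]
    rw [hfun]
    have hint := (hopen p q).interior_eq
    refine concaveOn_of_hasDerivWithinAt2_nonpos hconv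
      (f' := fun t => φ' (W α p.1 h p.2 k t) * W' α p.1 h p.2 k t)
      (f'' := fun t => φ'' (W α p.1 h p.2 k t) * W' α p.1 h p.2 k t * W' α p.1 h p.2 k t +
          φ' (W α p.1 h p.2 k t) * W'' α p.1 h p.2 k t)
      (fun t ht => (hFd _ _ _ _ _ _ (hmem p q t ht).1
        (hmem p q t ht).2).continuousAt.continuousWithinAt)
      (fun t ht => (hFd _ _ _ _ _ _ (hmem p q t (interior_subset ht)).1
        (hmem p q t (interior_subset ht)).2).hasDerivWithinAt)
      (fun t ht => (hF'd _ _ _ _ _ _ (hmem p q t (interior_subset ht)).1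
        (hmem p q t (interior_subset ht)).2).hasDerivWithinAt) ?_
    intro t ht
    obtain ⟨hx, hy⟩ := hmem p q t (interior_subset ht)
    obtain ⟨u, hu⟩ : ∃ u, φ u = p.1 + t * h := ⟨_, hφψ _ hx⟩
    obtain ⟨v, hv⟩ : ∃ v, φ v = p.2 + t * k := ⟨_, hφψ _ hy⟩
    simp only [hW, hW', hW'', ← hu, ← hv, hψφ, hψ', hψ'']
    set w := (1 - α) * u + α * v with hw
    have hsw := hs.2 (mem_univ u) (mem_univ v) (sub_nonneg.2 hα.2.le) hα.1.le (by ring)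
    simp only [smul_eq_mul, ← hw] at hsw
    set a := h / φ' u with ha
    set b := k / φ' v with hb
    have hu1 := hφ'pos u
    have hv1 := hφ'pos v
    have hw1 := hφ'pos w
    have hu2 := hφ''pos u
    have hv2 := hφ''pos v
    have hw2 := hφ''pos w
    have hα0 := hα.1
    have hα1 := sub_pos.2 hα.2
    have hcs := sq_add_le_weighted (a := a) (b := b) hα.1.le hα.2.le (hspos u) (hspos v)
    set Q := (1 - α) * (a ^ 2 / (φ' u / φ'' u)) + α * (b ^ 2 / (φ' v / φ'' v)) with hQ
    have hQnn : 0 ≤ Q := by positivity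
    have hbound : ((1 - α) * a + α * b) ^ 2 ≤ φ' w / φ'' w * Q :=
      hcs.trans (mul_le_mul_of_nonneg_right hsw hQnn)
    rw [div_mul_eq_mul_div, le_div_iff₀ hw2] at hbound
    have e1 : (1 - α) * (1 / φ' u * h) + α * (1 / φ' v * k) = (1 - α) * a + α * b := by
      rw [ha, hb]; ring
    have e2 : (1 - α) * (-φ'' u / φ' u ^ 3 * h * h) + α * (-φ'' v / φ' v ^ 3 * k * k) = -Q := by
      rw [hQ, ha, hb]
      field_simp
      ring
    rw [e1, e2]
    linarith

/-- Lemma 4: `g = −(φ⁻¹)'/(φ⁻¹)''` is concave on `(0,∞)` if and only if, for each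
`α ∈ (0,1)`, the map `F_α(x,y) = φ((1−α)φ⁻¹(x) + αφ⁻¹(y))` is concave on `(0,∞)×(0,∞)`. -/
theorem g_concave_iff_F_alpha_concave
    (φ φ' φ'' φinv φinv' φinv'' : ℝ → ℝ)
    -- φ is a strictly positive, strictly increasing deformed exponential
    (hφpos : ∀ u, 0 < φ u)
    (hφconv : ConvexOn ℝ Set.univ φ)
    (hφmono : StrictMono φ)
    (hφbot : Tendsto φ atBot (nhds 0))
    (hφtop : Tendsto φ atTop atTop)
    -- φ is twice differentiable with φ' > 0 and φ'' > 0
    (hφd : ∀ u, HasDerivAt φ (φ' u) u)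
    (hφd2 : ∀ u, HasDerivAt φ' (φ'' u) u)
    (hφ'pos : ∀ u, 0 < φ' u)
    (hφ''pos : ∀ u, 0 < φ'' u)
    -- φinv is the inverse of φ
    (hinv_left : ∀ u, φinv (φ u) = u)
    (hinv_right : ∀ x : ℝ, 0 < x → φ (φinv x) = x)
    -- φinv is twice differentiable on (0,∞) with (φ⁻¹)' > 0 and (φ⁻¹)'' < 0
    (hinvd : ∀ x : ℝ, 0 < x → HasDerivAt φinv (φinv' x) x)
    (hinvd2 : ∀ x : ℝ, 0 < x → HasDerivAt φinv' (φinv'' x) x)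
    (hinv'pos : ∀ x : ℝ, 0 < x → 0 < φinv' x)
    (hinv''neg : ∀ x : ℝ, 0 < x → φinv'' x < 0)
    (g : ℝ → ℝ) (hg : ∀ x, g x = -φinv' x / φinv'' x) :
    ConcaveOn ℝ (Set.Ioi 0) g ↔
      ∀ α ∈ Set.Ioo (0:ℝ) 1,
        ConcaveOn ℝ (Set.Ioi (0:ℝ) ×ˢ Set.Ioi (0:ℝ))
          (fun xy : ℝ × ℝ => φ ((1 - α) * φinv xy.1 + α * φinv xy.2)) := by
  have h1 : ∀ u, φinv' (φ u) * φ' u = 1 := fun u => by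
    have h : HasDerivAt (fun u => φinv (φ u)) (φinv' (φ u) * φ' u) u :=
      (hinvd _ (hφpos u)).comp u (hφd u)
    simp only [hinv_left] at h
    exact h.unique (hasDerivAt_id u)
  have hψ' : ∀ u, φinv' (φ u) = 1 / φ' u := fun u =>
    eq_one_div_of_mul_eq_one_left (h1 u)
  have hψ'' : ∀ u, φinv'' (φ u) = -φ'' u / φ' u ^ 3 := fun u => by
    have h : HasDerivAt (fun u => φinv' (φ u) * φ' u)
        (φinv'' (φ u) * φ' u * φ' u + φinv' (φ u) * φ'' u) u :=
      ((hinvd2 _ (hφpos u)).comp u (hφd u)).mul (hφd2 u)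
    simp only [h1] at h
    have h0 := h.unique (hasDerivAt_const u 1)
    have hne := (hφ'pos u).ne'
    rw [hψ'] at h0
    field_simp at h0 ⊢
    linarith
  have hgφ : ∀ u, g (φ u) = φ' u ^ 2 / φ'' u := fun u => by
    have := (hφ'pos u).ne'
    have := (hφ''pos u).ne'
    rw [hg, hψ', hψ'']
    field_simp
  rw [forall_concaveOn_interpolation_iff hφpos hφd hφd2 hφ'pos hφ''pos hinv_left hinv_right
    hinvd hinvd2 hψ' hψ'']
  exact ⟨concaveOn_deriv_div_deriv2 hφpos hφmono hφd hφd2 hφ'pos hφ''pos hgφ,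
    concaveOn_of_concaveOn_deriv_div_deriv2 hφmono (fun x hx => ⟨_, hinv_right x hx⟩)
      hφd hφd2 hφ'pos hφ''pos hgφ⟩
end

section
/- Let φ: ℝ → (0,∞) be a strictly increasing deformed exponential function which is twice differentiable with φ' > 0 and φ'' > 0, whose inverse φ⁻¹ is twice differentiable with (φ⁻¹)' > 0 and (φ⁻¹)'' < 0, and set g(x) = −(φ⁻¹)'(x)/(φ⁻¹)''(x). If g is concave on (0,∞), then the generalized divergence D_φ is jointly convex: for all probability distributions p₁, p₂, q₁, q₂ with strictly positive entries and all λ ∈ [0,1], D_φ(λp₁+(1−λ)p₂ ‖ λq₁+(1−λ)q₂) ≤ λ D_φ(p₁‖q₁) + (1−λ) D_φ(p₂‖q₂). -/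
open Filter Set

/-- A continuous function on `[a, b]` with nonnegative right derivative satisfies `f a ≤ f b`. -/
lemma le_of_hasDerivWithinAt_Ici_nonneg {f f' : ℝ → ℝ} {a b : ℝ} (hab : a ≤ b)
    (hf : ContinuousOn f (Icc a b)) (hf' : ∀ x ∈ Ico a b, HasDerivWithinAt f (f' x) (Ici x) x)
    (hnonneg : ∀ x ∈ Ico a b, 0 ≤ f' x) : f a ≤ f b :=
  image_le_of_deriv_right_le_deriv_boundary (f := fun _ => f a) (f' := fun _ => 0)
    continuousOn_const (fun _ _ => hasDerivWithinAt_const _ _ _) le_rfl hf hf' hnonneg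
    (right_mem_Icc.2 hab)

/-- A concave function on `(0, ∞)` has an antitone right derivative. -/
lemma ConcaveOn.exists_antitoneOn_hasDerivWithinAt_Ici {g : ℝ → ℝ}
    (hg : ConcaveOn ℝ (Ioi 0) g) :
    ∃ c : ℝ → ℝ, AntitoneOn c (Ioi 0) ∧ ∀ x, 0 < x → HasDerivWithinAt g (c x) (Ici x) x := by
  refine ⟨fun x => -derivWithin (-g) (Ioi x) x, ?_, fun x hx => ?_⟩
  · have h := hg.neg.monotoneOn_rightDeriv
    rw [interior_Ioi] at h
    exact h.neg
  · have h := hg.neg.hasDerivWithinAt_rightDeriv_of_mem_interior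
      (by rwa [interior_Ioi] : x ∈ interior (Ioi (0 : ℝ)))
    simpa using h.neg.Ici_of_Ioi

section

variable {f f' g c : ℝ → ℝ}

/-- If `f'' = -f' / g` with `g` concave, then `f' * g` is a concave function of `f`. -/
lemma deriv_mul_le_of_antitoneOn_rightDeriv
    (hf : ∀ x, 0 < x → HasDerivAt f (f' x) x)
    (hf' : ∀ x, 0 < x → HasDerivAt f' (-f' x / g x) x)
    (hf'pos : ∀ x, 0 < x → 0 < f' x) (hgpos : ∀ x, 0 < x → 0 < g x)
    (hgcont : ContinuousOn g (Ioi 0)) (hc : AntitoneOn c (Ioi 0))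
    (hgc : ∀ x, 0 < x → HasDerivWithinAt g (c x) (Ici x) x)
    {p q : ℝ} (hp : 0 < p) (hq : 0 < q) :
    f' q * g q ≤ f' p * g p + (f p - f q) * (1 - c p) := by
  set J : ℝ → ℝ := fun x => f' x * g x + f x * (1 - c p) with hJ
  have hJd : ∀ x, 0 < x → HasDerivWithinAt J (f' x * (c x - c p)) (Ici x) x := by
    intro x hx
    have h := ((hf' x hx).hasDerivWithinAt.mul (hgc x hx)).add
      ((hf x hx).hasDerivWithinAt.mul_const (1 - c p))
    refine h.congr_deriv ?_
    have := (hgpos x hx).ne'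
    field_simp
    ring
  have hfc : ContinuousOn f (Ioi 0) := fun x hx => (hf x hx).continuousAt.continuousWithinAt
  have hf'c : ContinuousOn f' (Ioi 0) := fun x hx => (hf' x hx).continuousAt.continuousWithinAt
  have hJc : ContinuousOn J (Ioi 0) := (hf'c.mul hgcont).add (hfc.mul continuousOn_const)
  suffices J q ≤ J p by simp only [hJ] at this; linarith
  rcases le_total q p with hqp | hpq
  · refine le_of_hasDerivWithinAt_Ici_nonneg hqp
      (hJc.mono fun x hx => hq.trans_le hx.1) (fun x hx => hJd x (hq.trans_le hx.1)) ?_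
    intro x hx
    have hx0 : 0 < x := hq.trans_le hx.1
    exact mul_nonneg (hf'pos x hx0).le (sub_nonneg.2 (hc hx0 hp hx.2.le))
  · refine neg_le_neg_iff.1 (le_of_hasDerivWithinAt_Ici_nonneg (f := fun x => -J x) hpq
      (hJc.mono fun x hx => hp.trans_le hx.1).neg
      (fun x hx => (hJd x (hp.trans_le hx.1)).neg) ?_)
    intro x hx
    have hx0 : 0 < x := hp.trans_le hx.1
    have h1 := hc hp hx0 hx.1
    have h2 := (hf'pos x hx0).le
    nlinarith

/-- The second derivative of the divergence along a segment, where `P = g p`, `Q = g q`,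
`E = f' q / f' p` and `c` is a one-sided derivative of `g` at `p`, is nonnegative. -/
lemma divergence_second_deriv_nonneg {a b K E P Q c : ℝ} (hP : 0 < P) (hQ : 0 < Q) (hE : 0 < E)
    (h : E * Q ≤ P + K * (1 - c)) :
    0 ≤ a * (((a + a * K / P - b * E) * P - K * (a * c)) / P ^ 2)
      - b * (E * (a / P - b / Q)) := by
  have key : a * (((a + a * K / P - b * E) * P - K * (a * c)) / P ^ 2)
      - b * (E * (a / P - b / Q)) =
      (a ^ 2 * (P + K * (1 - c) - E * Q) + E / Q * (a * Q - b * P) ^ 2) / P ^ 2 := by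
    field_simp
    ring
  rw [key]
  have := sub_nonneg.2 h
  positivity

/-- If `f'' = -f' / g` with `g` concave, then `(f p - f q) / f' p` is convex along segments on
which `p` is nondecreasing. -/
lemma convexOn_divergence_segment
    (hf : ∀ x, 0 < x → HasDerivAt f (f' x) x)
    (hf' : ∀ x, 0 < x → HasDerivAt f' (-f' x / g x) x)
    (hf'pos : ∀ x, 0 < x → 0 < f' x) (hgpos : ∀ x, 0 < x → 0 < g x)
    (hg : ConcaveOn ℝ (Ioi 0) g) {S : Set ℝ} (hS : Convex ℝ S) {a b p₀ q₀ : ℝ} (ha : 0 ≤ a)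
    (hp : ∀ t ∈ S, 0 < p₀ + t * a) (hq : ∀ t ∈ S, 0 < q₀ + t * b) :
    ConvexOn ℝ S fun t => (f (p₀ + t * a) - f (q₀ + t * b)) / f' (p₀ + t * a) := by
  obtain ⟨c, hc, hgc⟩ := hg.exists_antitoneOn_hasDerivWithinAt_Ici
  have hgcont : ContinuousOn g (Ioi 0) := hg.continuousOn isOpen_Ioi
  have hline : ∀ r s t : ℝ, HasDerivAt (fun t => r + t * s) s t := fun r s t =>
    (hasDerivAt_mul_const s).const_add r
  set K : ℝ → ℝ := fun t => (f (p₀ + t * a) - f (q₀ + t * b)) / f' (p₀ + t * a) with hK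
  set E : ℝ → ℝ := fun t => f' (q₀ + t * b) / f' (p₀ + t * a) with hE
  set G : ℝ → ℝ := fun t => g (p₀ + t * a) with hG
  set K' : ℝ → ℝ := fun t => a + a * (K t / G t) - b * E t with hK'
  have hKd : ∀ t ∈ S, HasDerivAt K (K' t) t := by
    intro t ht
    have h1 := (hf _ (hp t ht)).comp t (hline p₀ a t)
    have h2 := (hf _ (hq t ht)).comp t (hline q₀ b t)
    have h3 := (hf' _ (hp t ht)).comp t (hline p₀ a t)
    have hne := (hf'pos _ (hp t ht)).ne'
    refine ((h1.sub h2).div h3 hne).congr_deriv ?_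
    have := (hgpos _ (hp t ht)).ne'
    simp only [hK', hK, hG, hE, Function.comp_apply, Pi.sub_apply]
    field_simp
    ring
  have hEd : ∀ t ∈ S, HasDerivAt E (E t * (a / G t - b / g (q₀ + t * b))) t := by
    intro t ht
    have h2 := (hf' _ (hq t ht)).comp t (hline q₀ b t)
    have h3 := (hf' _ (hp t ht)).comp t (hline p₀ a t)
    have hne := (hf'pos _ (hp t ht)).ne'
    refine (h2.div h3 hne).congr_deriv ?_
    have := (hgpos _ (hp t ht)).ne'
    have := (hgpos _ (hq t ht)).ne'
    simp only [hG, hE, Function.comp_apply]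
    field_simp
    ring
  have hGd : ∀ t ∈ S, HasDerivWithinAt G (a * c (p₀ + t * a)) (Ici t) t := by
    intro t ht
    have hmaps : MapsTo (fun s => p₀ + s * a) (Ici t) (Ici (p₀ + t * a)) := fun s hs =>
      add_le_add_right (mul_le_mul_of_nonneg_right (mem_Ici.1 hs) ha) p₀
    exact ((hgc _ (hp t ht)).comp t (hline p₀ a t).hasDerivWithinAt hmaps).congr_deriv
      (mul_comm _ _)
  have hGc : ContinuousOn G S :=
    hgcont.comp (fun t _ => (hline p₀ a t).continuousAt.continuousWithinAt) hp
  have hKc : ContinuousOn K S := fun t ht => (hKd t ht).continuousAt.continuousWithinAt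
  have hK'c : ContinuousOn K' S :=
    (continuousOn_const.add (continuousOn_const.mul
      (hKc.div hGc fun t ht => (hgpos _ (hp t ht)).ne'))).sub
      (continuousOn_const.mul fun t ht => (hEd t ht).continuousAt.continuousWithinAt)
  have hK'mono : MonotoneOn K' S := by
    intro s hs t ht hst
    have hsub : Icc s t ⊆ S := hS.ordConnected.out hs ht
    refine le_of_hasDerivWithinAt_Ici_nonneg hst (hK'c.mono hsub)
      (f' := fun x => a * (((a + a * K x / G x - b * E x) * G x
        - K x * (a * c (p₀ + x * a))) / G x ^ 2)
        - b * (E x * (a / G x - b / g (q₀ + x * b)))) ?_ ?_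
    · intro x hx
      have hxS := hsub (Ico_subset_Icc_self hx)
      refine (((((hKd x hxS).hasDerivWithinAt.div (hGd x hxS)
        (hgpos _ (hp x hxS)).ne').const_mul a).const_add a).sub
        ((hEd x hxS).hasDerivWithinAt.const_mul b)).congr_deriv ?_
      simp only [hK', mul_div_assoc]
    · intro x hx
      have hxS := hsub (Ico_subset_Icc_self hx)
      have hpx := hf'pos _ (hp x hxS)
      refine divergence_second_deriv_nonneg (hgpos _ (hp x hxS)) (hgpos _ (hq x hxS))
        (div_pos (hf'pos _ (hq x hxS)) hpx) ?_
      have h := deriv_mul_le_of_antitoneOn_rightDeriv hf hf' hf'pos hgpos hgcont hc hgc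
        (hp x hxS) (hq x hxS)
      simp only [hE, hK, hG]
      rw [div_mul_eq_mul_div, div_mul_eq_mul_div, div_le_iff₀ hpx, add_mul,
        div_mul_cancel₀ _ hpx.ne']
      linarith
  refine MonotoneOn.convexOn_of_deriv hS hKc
    (fun t ht => (hKd t (interior_subset ht)).differentiableAt.differentiableWithinAt) ?_
  intro s hs t ht hst
  rw [(hKd s (interior_subset hs)).deriv, (hKd t (interior_subset ht)).deriv]
  exact hK'mono (interior_subset hs) (interior_subset ht) hst

/-- If `f'' = -f' / g` with `g` concave, then `(f p - f q) / f' p` is jointly convex. -/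
lemma divergence_jointly_convex
    (hf : ∀ x, 0 < x → HasDerivAt f (f' x) x)
    (hf' : ∀ x, 0 < x → HasDerivAt f' (-f' x / g x) x)
    (hf'pos : ∀ x, 0 < x → 0 < f' x) (hgpos : ∀ x, 0 < x → 0 < g x)
    (hg : ConcaveOn ℝ (Ioi 0) g) {p₁ p₂ q₁ q₂ l : ℝ} (hp₁ : 0 < p₁) (hp₂ : 0 < p₂)
    (hq₁ : 0 < q₁) (hq₂ : 0 < q₂) (hl : l ∈ Icc (0 : ℝ) 1) :
    (f (l * p₁ + (1 - l) * p₂) - f (l * q₁ + (1 - l) * q₂)) / f' (l * p₁ + (1 - l) * p₂) ≤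
      l * ((f p₁ - f q₁) / f' p₁) + (1 - l) * ((f p₂ - f q₂) / f' p₂) := by
  wlog h : p₂ ≤ p₁ generalizing p₁ p₂ q₁ q₂ l
  · have := this (l := 1 - l) hp₂ hp₁ hq₂ hq₁ ⟨by linarith [hl.2], by linarith [hl.1]⟩
      (not_le.1 h).le
    rw [sub_sub_cancel] at this
    simpa only [add_comm] using this
  have hpos : ∀ x y : ℝ, 0 < x → 0 < y → ∀ t ∈ Icc (0 : ℝ) 1, 0 < y + t * (x - y) :=
    fun x y hx hy t ht =>
      (convex_Ioi (0 : ℝ)).add_smul_sub_mem (mem_Ioi.2 hy) (mem_Ioi.2 hx) ht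
  have hconv := convexOn_divergence_segment hf hf' hf'pos hgpos hg (convex_Icc 0 1)
    (sub_nonneg.2 h) (hpos p₁ p₂ hp₁ hp₂) (hpos q₁ q₂ hq₁ hq₂)
  have := hconv.2 (right_mem_Icc.2 zero_le_one) (left_mem_Icc.2 zero_le_one) hl.1
    (sub_nonneg.2 hl.2) (add_sub_cancel l 1)
  simp only [smul_eq_mul, mul_one, mul_zero, add_zero, one_mul, zero_mul,
    add_sub_cancel] at this
  rwa [show p₂ + l * (p₁ - p₂) = l * p₁ + (1 - l) * p₂ by ring,
    show q₂ + l * (q₁ - q₂) = l * q₁ + (1 - l) * q₂ by ring] at this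

end

/-- Proposition 2: if `g = −(φ⁻¹)'/(φ⁻¹)''` is concave on `(0,∞)`, then the
generalized divergence `D_φ` is jointly convex. -/
theorem joint_convexity_of_g_concave
    (φ φ' φ'' φinv φinv' φinv'' : ℝ → ℝ)
    -- φ is a strictly positive, strictly increasing deformed exponential
    (hφpos : ∀ u, 0 < φ u)
    (hφconv : ConvexOn ℝ Set.univ φ)
    (hφmono : StrictMono φ)
    (hφbot : Tendsto φ atBot (nhds 0))
    (hφtop : Tendsto φ atTop atTop)
    -- φ is twice differentiable with φ' > 0 and φ'' > 0
    (hφd : ∀ u, HasDerivAt φ (φ' u) u)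
    (hφd2 : ∀ u, HasDerivAt φ' (φ'' u) u)
    (hφ'pos : ∀ u, 0 < φ' u)
    (hφ''pos : ∀ u, 0 < φ'' u)
    -- φinv is the inverse of φ
    (hinv_left : ∀ u, φinv (φ u) = u)
    (hinv_right : ∀ x : ℝ, 0 < x → φ (φinv x) = x)
    -- φinv is twice differentiable on (0,∞) with (φ⁻¹)' > 0 and (φ⁻¹)'' < 0
    (hinvd : ∀ x : ℝ, 0 < x → HasDerivAt φinv (φinv' x) x)
    (hinvd2 : ∀ x : ℝ, 0 < x → HasDerivAt φinv' (φinv'' x) x)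
    (hinv'pos : ∀ x : ℝ, 0 < x → 0 < φinv' x)
    (hinv''neg : ∀ x : ℝ, 0 < x → φinv'' x < 0)
    -- g is concave on (0,∞)
    (g : ℝ → ℝ) (hg : ∀ x, g x = -φinv' x / φinv'' x)
    (hgconc : ConcaveOn ℝ (Set.Ioi 0) g)
    -- p₁, p₂, q₁, q₂ are probability distributions with strictly positive entries
    (n : ℕ) (p₁ p₂ q₁ q₂ : Fin n → ℝ)
    (hp₁ : ∀ i, 0 < p₁ i) (hp₂ : ∀ i, 0 < p₂ i)
    (hq₁ : ∀ i, 0 < q₁ i) (hq₂ : ∀ i, 0 < q₂ i)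
    (hp₁s : ∑ i, p₁ i = 1) (hp₂s : ∑ i, p₂ i = 1)
    (hq₁s : ∑ i, q₁ i = 1) (hq₂s : ∑ i, q₂ i = 1)
    (l : ℝ) (hl : l ∈ Set.Icc (0:ℝ) 1) :
    ∑ i, (φinv (l * p₁ i + (1 - l) * p₂ i) - φinv (l * q₁ i + (1 - l) * q₂ i)) /
        φinv' (l * p₁ i + (1 - l) * p₂ i)
      ≤ l * ∑ i, (φinv (p₁ i) - φinv (q₁ i)) / φinv' (p₁ i)
        + (1 - l) * ∑ i, (φinv (p₂ i) - φinv (q₂ i)) / φinv' (p₂ i) := by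
  rw [Finset.mul_sum, Finset.mul_sum, ← Finset.sum_add_distrib]
  refine Finset.sum_le_sum fun i _ => ?_
  refine divergence_jointly_convex hinvd (g := g) (fun x hx => ?_) hinv'pos (fun x hx => ?_)
    hgconc (hp₁ i) (hp₂ i) (hq₁ i) (hq₂ i) hl
  · refine (hinvd2 x hx).congr_deriv ?_
    have h1 := (hinv'pos x hx).ne'
    have h2 := (hinv''neg x hx).ne
    rw [hg]
    field_simp
  · rw [hg]
    exact div_pos_of_neg_of_neg (neg_neg_of_pos (hinv'pos x hx)) (hinv''neg x hx)
end

section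
/- Let φ: ℝ → (0,∞) be a strictly increasing deformed exponential function which is twice differentiable with φ' > 0, whose inverse φ⁻¹ is twice differentiable with (φ⁻¹)' > 0 and (φ⁻¹)'' continuous and strictly negative, and set g(x) = −(φ⁻¹)'(x)/(φ⁻¹)''(x). Suppose that for some n ≥ 3 the generalized divergence D_φ on probability distributions over {1,…,n} with strictly positive entries is jointly convex, i.e., D_φ(λp₁+(1−λ)p₂ ‖ λq₁+(1−λ)q₂) ≤ λ D_φ(p₁‖q₁) + (1−λ) D_φ(p₂‖q₂) for all such distributions and λ ∈ [0,1]. Then g((x+y)/2) ≥ (g(x)+g(y))/2 for all x, y ∈ (0,1) with x+y ∈ (0,1). -/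
open Filter Set

open Topology in
/-- Second-order necessary condition at a local minimum. -/
theorem IsLocalMin.second_deriv_nonneg {u u' : ℝ → ℝ} {c : ℝ}
    (hmin : IsLocalMin u 0) (hu : ∀ᶠ t in 𝓝 (0 : ℝ), HasDerivAt u (u' t) t)
    (hu' : HasDerivAt u' c 0) : 0 ≤ c := by
  by_contra! hc
  have hu0 : u' 0 = 0 := hmin.hasDerivAt_eq_zero hu.self_of_nhds
  have hslope : ∀ᶠ t in 𝓝 (0 : ℝ), t ≠ 0 → slope u' 0 t < 0 :=
    eventually_nhdsWithin_iff.1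
      ((hasDerivAt_iff_tendsto_slope.1 hu').eventually (gt_mem_nhds hc))
  obtain ⟨δ, hδ, h⟩ := Metric.eventually_nhds_iff.1 (hu.and (hslope.and hmin))
  have hball : ∀ t, 0 ≤ t → t ≤ δ / 2 → dist t 0 < δ := by
    intro t h0 h1
    rw [Real.dist_eq, sub_zero, abs_of_nonneg h0]
    linarith
  obtain ⟨t, ⟨ht0, ht1⟩, ht⟩ := exists_hasDerivAt_eq_slope u u' (half_pos hδ)
    (fun t ht => (h (hball t ht.1 ht.2)).1.continuousAt.continuousWithinAt)
    (fun t ht => (h (hball t ht.1.le ht.2.le)).1)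
  have hneg : u' t < 0 := by
    have hs := (h (hball t ht0.le ht1.le)).2.1 ht0.ne'
    rw [slope_def_field, hu0, sub_zero, sub_zero] at hs
    exact (div_neg_iff.1 hs).elim (fun hh => absurd hh.2 ht0.not_gt) (fun hh => hh.1)
  have hpos : 0 ≤ u' t := by
    rw [ht]
    exact div_nonneg (sub_nonneg.2 (h (hball _ (half_pos hδ).le le_rfl)).2.2)
      (by linarith)
  exact hneg.not_ge hpos

/-- Joint convexity of `(p, q) ↦ ∑ i, F (p i) (q i)` on the open simplex, applied to a pair of
distributions and to the pair obtained by swapping the first two coordinates. -/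
theorem two_mul_midpoint_le_of_joint_convexity {F : ℝ → ℝ → ℝ} {n : ℕ} (hn : 3 ≤ n)
    (hF : ∀ p₁ p₂ q₁ q₂ : Fin n → ℝ,
      (∀ i, 0 < p₁ i) → (∀ i, 0 < p₂ i) → (∀ i, 0 < q₁ i) → (∀ i, 0 < q₂ i) →
      ∑ i, p₁ i = 1 → ∑ i, p₂ i = 1 → ∑ i, q₁ i = 1 → ∑ i, q₂ i = 1 →
      ∀ l ∈ Set.Icc (0 : ℝ) 1,
        ∑ i, F (l * p₁ i + (1 - l) * p₂ i) (l * q₁ i + (1 - l) * q₂ i)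
          ≤ l * ∑ i, F (p₁ i) (q₁ i) + (1 - l) * ∑ i, F (p₂ i) (q₂ i))
    {x y a b : ℝ} (hx : 0 < x) (hy : 0 < y) (ha : 0 < a) (hb : 0 < b)
    (hxy : x + y < 1) (hab : a + b < 1) :
    2 * F ((x + y) / 2) ((a + b) / 2) ≤ F x a + F y b := by
  obtain ⟨k, rfl⟩ : ∃ k, n = k + 1 + 1 := ⟨n - 2, by omega⟩
  have hk : (0 : ℝ) < k := by
    have : 0 < k := by omega
    exact_mod_cast this
  set d : ℝ → ℝ → Fin (k + 1 + 1) → ℝ := fun s t =>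
    Fin.cons s (Fin.cons t fun _ => (1 - s - t) / k) with hd
  have hdpos : ∀ s t, 0 < s → 0 < t → s + t < 1 → ∀ i, 0 < d s t i := by
    intro s t hs ht hst
    have : 0 < (1 - s - t) / k := div_pos (by linarith) hk
    simp [hd, Fin.forall_fin_succ, hs, ht, this]
  have hdsum : ∀ s t, ∑ i, d s t i = 1 := by
    intro s t
    simp only [hd, Fin.sum_univ_succ, Fin.cons_zero, Fin.cons_succ, Finset.sum_const,
      Finset.card_univ, Fintype.card_fin, nsmul_eq_mul]
    field_simp
    ring
  have key := hF (d x y) (d y x) (d a b) (d b a) (hdpos _ _ hx hy hxy)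
    (hdpos _ _ hy hx (by linarith)) (hdpos _ _ ha hb hab) (hdpos _ _ hb ha (by linarith))
    (hdsum _ _) (hdsum _ _) (hdsum _ _) (hdsum _ _) (1 / 2) (by norm_num)
  have hmid : ∀ s t : ℝ, 1 / 2 * s + (1 - 1 / 2) * t = (s + t) / 2 := fun s t => by ring
  simp only [hd, Fin.sum_univ_succ, Fin.cons_zero, Fin.cons_succ, Finset.sum_const,
    Finset.card_univ, Fintype.card_fin, nsmul_eq_mul, hmid, sub_right_comm (1 : ℝ) y x,
    sub_right_comm (1 : ℝ) b a, add_self_div_two, add_comm y x, add_comm b a] at key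
  linarith

/-- Lemma 5: if the generalized divergence `D_φ` is jointly convex for some `n ≥ 3`,
then `g = −(φ⁻¹)'/(φ⁻¹)''` satisfies the midpoint concavity inequality
`g((x+y)/2) ≥ (g(x)+g(y))/2` for `x, y, x+y ∈ (0,1)`. -/
theorem midpoint_concavity_of_joint_convexity
    (φ φ' φinv φinv' φinv'' : ℝ → ℝ)
    -- φ is a strictly positive, strictly increasing deformed exponential
    (hφpos : ∀ u, 0 < φ u)
    (hφconv : ConvexOn ℝ Set.univ φ)
    (hφmono : StrictMono φ)
    (hφbot : Tendsto φ atBot (nhds 0))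
    (hφtop : Tendsto φ atTop atTop)
    -- φ is twice differentiable with φ' > 0
    (hφd : ∀ u, HasDerivAt φ (φ' u) u)
    (hφ'pos : ∀ u, 0 < φ' u)
    -- φinv is the inverse of φ
    (hinv_left : ∀ u, φinv (φ u) = u)
    (hinv_right : ∀ x : ℝ, 0 < x → φ (φinv x) = x)
    -- φinv is twice differentiable on (0,∞) with (φ⁻¹)' > 0 and (φ⁻¹)'' continuous, < 0
    (hinvd : ∀ x : ℝ, 0 < x → HasDerivAt φinv (φinv' x) x)
    (hinvd2 : ∀ x : ℝ, 0 < x → HasDerivAt φinv' (φinv'' x) x)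
    (hinv'pos : ∀ x : ℝ, 0 < x → 0 < φinv' x)
    (hinv''neg : ∀ x : ℝ, 0 < x → φinv'' x < 0)
    (hinv''cont : ContinuousOn φinv'' (Set.Ioi 0))
    (g : ℝ → ℝ) (hg : ∀ x, g x = -φinv' x / φinv'' x)
    (n : ℕ) (hn : 3 ≤ n)
    -- D_φ is jointly convex on probability distributions over {1,…,n}
    (hjc : ∀ p₁ p₂ q₁ q₂ : Fin n → ℝ,
      (∀ i, 0 < p₁ i) → (∀ i, 0 < p₂ i) → (∀ i, 0 < q₁ i) → (∀ i, 0 < q₂ i) →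
      ∑ i, p₁ i = 1 → ∑ i, p₂ i = 1 → ∑ i, q₁ i = 1 → ∑ i, q₂ i = 1 →
      ∀ l ∈ Set.Icc (0:ℝ) 1,
        ∑ i, (φinv (l * p₁ i + (1 - l) * p₂ i) - φinv (l * q₁ i + (1 - l) * q₂ i)) /
            φinv' (l * p₁ i + (1 - l) * p₂ i)
          ≤ l * ∑ i, (φinv (p₁ i) - φinv (q₁ i)) / φinv' (p₁ i)
            + (1 - l) * ∑ i, (φinv (p₂ i) - φinv (q₂ i)) / φinv' (p₂ i)) :
    ∀ x y : ℝ, x ∈ Set.Ioo (0:ℝ) 1 → y ∈ Set.Ioo (0:ℝ) 1 →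
      x + y ∈ Set.Ioo (0:ℝ) 1 → (g x + g y) / 2 ≤ g ((x + y) / 2) := by
  intro x y hx hy hxy
  have hgpos : ∀ z, 0 < z → 0 < g z := fun z hz => by
    rw [hg]
    exact div_pos_of_neg_of_neg (neg_neg_of_pos (hinv'pos z hz)) (hinv''neg z hz)
  have hm : 0 < (x + y) / 2 := half_pos hxy.1
  set m := (x + y) / 2 with hmdef
  set a := (g x + g y) / 2 with hadef
  have hcurve : ∀ z h : ℝ, ContinuousAt (fun t : ℝ => z + t * h) 0 := fun z h => by fun_prop
  have hev : ∀ z h : ℝ, 0 < z → ∀ᶠ t in nhds (0 : ℝ), 0 < z + t * h := fun z h hz =>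
    (hcurve z h).eventually (lt_mem_nhds (by simpa using hz))
  have hline : ∀ z h t : ℝ, HasDerivAt (fun t : ℝ => z + t * h) h t := fun z h t => by
    simpa using ((hasDerivAt_id t).mul_const h).const_add z
  have hF1 : ∀ z h t : ℝ, 0 < z + t * h → HasDerivAt
      (fun t => (φinv z - φinv (z + t * h)) / φinv' z) (-(φinv' (z + t * h) * h) / φinv' z) t :=
    fun z h t ht => (((hinvd _ ht).comp t (hline z h t)).const_sub (φinv z)).div_const _
  have hF2 : ∀ z, 0 < z → ∀ h : ℝ, HasDerivAt
      (fun t => -(φinv' (z + t * h) * h) / φinv' z) (h ^ 2 / g z) 0 := by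
    intro z hz h
    have h0 : 0 < z + 0 * h := by simpa using hz
    have := (((((hinvd2 _ h0).comp 0 (hline z h 0)).mul_const h).neg).div_const (φinv' z))
    refine this.congr_deriv ?_
    have h1 := (hinv'pos z hz).ne'
    have h2 := (hinv''neg z hz).ne
    rw [hg, zero_mul, add_zero]
    field_simp
  have hc := IsLocalMin.second_deriv_nonneg
    (u := fun t => (φinv x - φinv (x + t * g x)) / φinv' x
      + (φinv y - φinv (y + t * g y)) / φinv' y
      - 2 * ((φinv m - φinv (m + t * a)) / φinv' m))
    (u' := fun t => -(φinv' (x + t * g x) * g x) / φinv' x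
      + -(φinv' (y + t * g y) * g y) / φinv' y
      - 2 * (-(φinv' (m + t * a) * a) / φinv' m))
    (c := g x ^ 2 / g x + g y ^ 2 / g y - 2 * (a ^ 2 / g m))
    (by
      filter_upwards [hev x (g x) hx.1, hev y (g y) hy.1,
        hev (1 - (x + y)) (-(g x + g y)) (by linarith [hxy.2])] with t h1 h2 h3
      have key := two_mul_midpoint_le_of_joint_convexity
        (F := fun p q => (φinv p - φinv q) / φinv' p) hn hjc hx.1 hy.1 h1 h2 hxy.2
        (by linarith)
      have hmt : (x + t * g x + (y + t * g y)) / 2 = m + t * a := by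
        rw [hmdef, hadef]
        ring
      simp only [hmt, ← hmdef] at key
      simp only [zero_mul, add_zero, sub_self, zero_div, mul_zero]
      linarith)
    (by
      filter_upwards [hev x (g x) hx.1, hev y (g y) hy.1, hev m a hm] with t h1 h2 h3
      exact ((hF1 x _ t h1).add (hF1 y _ t h2)).sub ((hF1 m _ t h3).const_mul 2))
    (((hF2 x hx.1 _).add (hF2 y hy.1 _)).sub ((hF2 m hm _).const_mul 2))
  have hx' := hgpos x hx.1
  have hy' := hgpos y hy.1
  have hm' := hgpos m hm
  have ha : 0 < a := half_pos (add_pos hx' hy')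
  rw [sq, mul_self_div_self, sq, mul_self_div_self] at hc
  have hle : a ^ 2 / g m ≤ a := by linarith
  rw [div_le_iff₀ hm', sq] at hle
  exact le_of_mul_le_mul_left hle ha
end

section
/- Let n ≥ 3 and let φ: ℝ → (0,∞) be a strictly increasing deformed exponential function which is twice differentiable with φ' > 0 and φ'' > 0, whose inverse φ⁻¹ is twice differentiable with (φ⁻¹)' > 0 and (φ⁻¹)'' continuous and strictly negative. Then the generalized divergence D_φ on probability distributions over {1,…,n} with strictly positive entries satisfies the partition inequality D_φ(p‖q) ≥ D_φ(p^𝒜‖q^𝒜) for all partitions 𝒜 and is jointly convex, if and only if there exist q₀ > 0, b > 0 and a ∈ ℝ such that φ⁻¹(x) = b·ln_{q₀}(x) − a for all x ∈ (0,1), where ln_{q₀}(x) = (x^{1−q₀} − 1)/(1 − q₀) for q₀ ≠ 1 and ln₁(x) = ln x. -/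
open Filter Set

open Topology

/-- The Tsallis `q`-logarithm. -/
noncomputable def tsallisLog (q x : ℝ) : ℝ :=
  if q = 1 then Real.log x else (x ^ (1 - q) - 1) / (1 - q)

lemma hasDerivAt_tsallisLog (q : ℝ) {x : ℝ} (hx : 0 < x) :
    HasDerivAt (tsallisLog q) (x ^ (-q)) x := by
  unfold tsallisLog
  split_ifs with h
  · subst h
    simpa [Real.rpow_neg_one] using Real.hasDerivAt_log hx.ne'
  · have hq : 1 - q ≠ 0 := sub_ne_zero.mpr (Ne.symm h)
    have := ((Real.hasDerivAt_rpow_const (p := 1 - q) (Or.inl hx.ne')).sub_const 1).div_const (1 - q)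
    refine this.congr_deriv ?_
    rw [mul_div_cancel_left₀ _ hq]
    congr 1
    ring

lemma concaveOn_tsallisLog {q : ℝ} (hq : 0 < q) : ConcaveOn ℝ (Ioi 0) (tsallisLog q) := by
  refine AntitoneOn.concaveOn_of_deriv (convex_Ioi 0)
    (fun x hx => (hasDerivAt_tsallisLog q hx).continuousAt.continuousWithinAt) ?_ ?_
  · rw [interior_Ioi]
    exact fun x hx => (hasDerivAt_tsallisLog q hx).differentiableAt.differentiableWithinAt
  · rw [interior_Ioi]
    intro x hx y hy hxy
    rw [(hasDerivAt_tsallisLog q hx).deriv, (hasDerivAt_tsallisLog q hy).deriv]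
    exact Real.rpow_le_rpow_of_nonpos hx hxy (by linarith)

lemma tsallisLog_sub_div (q : ℝ) {x y : ℝ} (hx : 0 < x) (hy : 0 < y) :
    (tsallisLog q x - tsallisLog q y) / x ^ (-q) = -(x * tsallisLog q (y / x)) := by
  unfold tsallisLog
  split_ifs with h
  · subst h
    rw [Real.rpow_neg_one, Real.log_div hy.ne' hx.ne', div_inv_eq_mul]
    ring
  · have hq : 1 - q ≠ 0 := sub_ne_zero.mpr (Ne.symm h)
    have h0 : x ^ (1 - q) = x * x ^ (-q) := by
      rw [sub_eq_add_neg, Real.rpow_add hx, Real.rpow_one]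
    have h1 : 0 < x ^ (-q) := Real.rpow_pos_of_pos hx _
    rw [Real.div_rpow hy.le hx.le, h0]
    field_simp
    ring

lemma tsallisLog_one (q : ℝ) : tsallisLog q 1 = 0 := by
  simp [tsallisLog]

/-- The perspective of a concave function is superadditive. -/
lemma ConcaveOn.sum_perspective_le {L : ℝ → ℝ} (hL : ConcaveOn ℝ (Ioi 0) L) {ι : Type*}
    {s : Finset ι} (hs : s.Nonempty) {p r : ι → ℝ} (hp : ∀ i, 0 < p i) (hr : ∀ i, 0 < r i) :
    ∑ i ∈ s, p i * L (r i / p i) ≤ (∑ i ∈ s, p i) * L ((∑ i ∈ s, r i) / ∑ i ∈ s, p i) := by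
  have hP : 0 < ∑ i ∈ s, p i := Finset.sum_pos (fun i _ => hp i) hs
  have h := hL.le_map_sum (t := s) (w := fun i => p i / ∑ i ∈ s, p i) (p := fun i => r i / p i)
    (fun i _ => (div_pos (hp i) hP).le) (by rw [← Finset.sum_div, div_self hP.ne'])
    (fun i _ => div_pos (hr i) (hp i))
  simp only [smul_eq_mul] at h
  have h1 : ∀ i ∈ s, p i / (∑ i ∈ s, p i) * (r i / p i) = r i / ∑ i ∈ s, p i := fun i _ => by
    have := (hp i).ne'
    field_simp
  rw [Finset.sum_congr rfl h1, ← Finset.sum_div] at h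
  have h2 := mul_le_mul_of_nonneg_left h hP.le
  rw [Finset.mul_sum] at h2
  refine le_trans (le_of_eq (Finset.sum_congr rfl fun i _ => ?_)) h2
  field_simp

/-- The perspective of a concave function is jointly concave. -/
lemma ConcaveOn.perspective_le {L : ℝ → ℝ} (hL : ConcaveOn ℝ (Ioi 0) L) {l x y u v : ℝ}
    (hl : l ∈ Icc (0 : ℝ) 1) (hx : 0 < x) (hy : 0 < y) (hu : 0 < u) (hv : 0 < v) :
    l * (x * L (u / x)) + (1 - l) * (y * L (v / y)) ≤
      (l * x + (1 - l) * y) * L ((l * u + (1 - l) * v) / (l * x + (1 - l) * y)) := by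
  have hX : 0 < l * x + (1 - l) * y := by
    have := convex_Ioi (𝕜 := ℝ) (0 : ℝ) hx hy hl.1 (sub_nonneg.mpr hl.2) (by ring)
    simpa using this
  have h := hL.2 (div_pos hu hx) (div_pos hv hy)
    (div_nonneg (mul_nonneg hl.1 hx.le) hX.le)
    (div_nonneg (mul_nonneg (sub_nonneg.mpr hl.2) hy.le) hX.le)
    (by rw [← add_div, div_self hX.ne'])
  simp only [smul_eq_mul] at h
  have h1 : l * x / (l * x + (1 - l) * y) * (u / x) + (1 - l) * y / (l * x + (1 - l) * y) * (v / y)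
      = (l * u + (1 - l) * v) / (l * x + (1 - l) * y) := by
    field_simp
  rw [h1] at h
  refine le_trans (le_of_eq ?_) (mul_le_mul_of_nonneg_left h hX.le)
  field_simp

/-- The summand `(f x - f y) / f' x` of the generalized divergence, for `f = φ⁻¹`. -/
noncomputable def divTerm (f f' : ℝ → ℝ) (x y : ℝ) : ℝ := (f x - f y) / f' x

section Tsallis

variable {f f' : ℝ → ℝ} {q b a : ℝ}

lemma divTerm_eq_of_eq_tsallisLog (hf : ∀ x, 0 < x → HasDerivAt f (f' x) x) (hb : 0 < b)
    (h : ∀ x ∈ Ioo (0 : ℝ) 1, f x = b * tsallisLog q x - a)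
    {x y : ℝ} (hx : x ∈ Ioo (0 : ℝ) 1) (hy : y ∈ Ioo (0 : ℝ) 1) :
    divTerm f f' x y = -(x * tsallisLog q (y / x)) := by
  have hd : f' x = b * x ^ (-q) := by
    refine (hf x hx.1).unique ?_
    refine (((hasDerivAt_tsallisLog q hx.1).const_mul b).sub_const a).congr_of_eventuallyEq ?_
    filter_upwards [Ioo_mem_nhds hx.1 hx.2] with z hz using h z hz
  rw [divTerm, h x hx, h y hy, hd, ← tsallisLog_sub_div q hx.1 hy.1]
  have : 0 < x ^ (-q) := Real.rpow_pos_of_pos hx.1 _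
  field_simp
  ring

lemma lt_one_of_sum_eq_one {n : ℕ} (hn : 3 ≤ n) {p : Fin n → ℝ} (hp : ∀ i, 0 < p i)
    (hs : ∑ i, p i = 1) (i : Fin n) : p i < 1 := by
  have : Nontrivial (Fin n) := Fin.nontrivial_iff_two_le.mpr (by omega)
  obtain ⟨j, hj⟩ := exists_ne i
  rw [← hs]
  exact Finset.single_lt_sum hj (Finset.mem_univ i) (Finset.mem_univ j) (hp j)
    fun k _ _ => (hp k).le

lemma partition_of_eq_tsallisLog (hf : ∀ x, 0 < x → HasDerivAt f (f' x) x) (hq : 0 < q)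
    (hb : 0 < b) (h : ∀ x ∈ Ioo (0 : ℝ) 1, f x = b * tsallisLog q x - a)
    {n : ℕ} (hn : 3 ≤ n) {k : ℕ} {A : Fin n → Fin k} (hA : Function.Surjective A)
    {p r : Fin n → ℝ} (hp : ∀ i, 0 < p i) (hr : ∀ i, 0 < r i)
    (hps : ∑ i, p i = 1) (hrs : ∑ i, r i = 1) :
    ∑ j : Fin k, divTerm f f' (∑ i ∈ Finset.univ.filter (fun i => A i = j), p i)
      (∑ i ∈ Finset.univ.filter (fun i => A i = j), r i) ≤ ∑ i, divTerm f f' (p i) (r i) := by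
  have hterm : ∀ i, divTerm f f' (p i) (r i) = -(p i * tsallisLog q (r i / p i)) := fun i =>
    divTerm_eq_of_eq_tsallisLog hf hb h ⟨hp i, lt_one_of_sum_eq_one hn hp hps i⟩
      ⟨hr i, lt_one_of_sum_eq_one hn hr hrs i⟩
  rw [← Finset.sum_fiberwise Finset.univ A (fun i => divTerm f f' (p i) (r i))]
  refine Finset.sum_le_sum fun j _ => ?_
  have hne : (Finset.univ.filter (fun i => A i = j)).Nonempty := by
    obtain ⟨i, hi⟩ := hA j
    exact ⟨i, by simp [hi]⟩
  simp only [hterm, Finset.sum_neg_distrib]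
  refine le_trans (le_of_eq ?_)
    (neg_le_neg ((concaveOn_tsallisLog hq).sum_perspective_le hne hp hr))
  by_cases hu : Finset.univ.filter (fun i => A i = j) = Finset.univ
  · rw [hu, hps, hrs]
    simp [divTerm, tsallisLog_one]
  · obtain ⟨i, hi⟩ : ∃ i, i ∉ Finset.univ.filter (fun i => A i = j) := by
      by_contra! hc
      exact hu (Finset.eq_univ_of_forall hc)
    have hlt : ∀ g : Fin n → ℝ, (∀ i, 0 < g i) → ∑ i, g i = 1 →
        ∑ i ∈ Finset.univ.filter (fun i => A i = j), g i ∈ Ioo (0 : ℝ) 1 := fun g hg hgs =>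
      ⟨Finset.sum_pos (fun i _ => hg i) hne, hgs ▸ Finset.sum_lt_sum_of_subset
        (Finset.subset_univ _) (Finset.mem_univ i) hi (hg i) fun k _ _ => (hg k).le⟩
    exact divTerm_eq_of_eq_tsallisLog hf hb h (hlt p hp hps) (hlt r hr hrs)

lemma divTerm_convex_of_eq_tsallisLog (hf : ∀ x, 0 < x → HasDerivAt f (f' x) x) (hq : 0 < q)
    (hb : 0 < b) (h : ∀ x ∈ Ioo (0 : ℝ) 1, f x = b * tsallisLog q x - a) {l x y u v : ℝ}
    (hl : l ∈ Icc (0 : ℝ) 1) (hx : x ∈ Ioo (0 : ℝ) 1) (hy : y ∈ Ioo (0 : ℝ) 1)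
    (hu : u ∈ Ioo (0 : ℝ) 1) (hv : v ∈ Ioo (0 : ℝ) 1) :
    divTerm f f' (l * x + (1 - l) * y) (l * u + (1 - l) * v) ≤
      l * divTerm f f' x u + (1 - l) * divTerm f f' y v := by
  have hmem : ∀ {s t : ℝ}, s ∈ Ioo (0 : ℝ) 1 → t ∈ Ioo (0 : ℝ) 1 →
      l * s + (1 - l) * t ∈ Ioo (0 : ℝ) 1 := fun hs ht => by
    simpa using convex_Ioo (𝕜 := ℝ) (0 : ℝ) 1 hs ht hl.1 (sub_nonneg.mpr hl.2) (by ring)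
  rw [divTerm_eq_of_eq_tsallisLog hf hb h (hmem hx hy) (hmem hu hv),
    divTerm_eq_of_eq_tsallisLog hf hb h hx hu, divTerm_eq_of_eq_tsallisLog hf hb h hy hv]
  have := (concaveOn_tsallisLog hq).perspective_le hl hx.1 hy.1 hu.1 hv.1
  linarith

end Tsallis

section SecondOrder

variable {f f' f'' : ℝ → ℝ}

lemma tendsto_divTerm_second_order (hf : ∀ x, 0 < x → HasDerivAt f (f' x) x)
    (hf' : ∀ x, 0 < x → HasDerivAt f' (f'' x) x) (hpos : ∀ x, 0 < x → 0 < f' x)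
    {x : ℝ} (hx : 0 < x) (α : ℝ) :
    Tendsto (fun t => (divTerm f f' x (x + t * α) + t * α) / t ^ 2) (𝓝[>] 0)
      (𝓝 (-(f'' x / f' x) * α ^ 2 / 2)) := by
  have hline : ∀ t : ℝ, HasDerivAt (fun t => x + t * α) α t := fun t => by
    simpa using ((hasDerivAt_id t).mul_const α).const_add x
  have hnear : ∀ᶠ t in 𝓝 (0 : ℝ), 0 < x + t * α :=
    (hline 0).continuousAt.eventually (lt_mem_nhds (by simpa using hx))
  have hnum : ∀ᶠ t in 𝓝[>] (0 : ℝ), HasDerivAt (fun t => divTerm f f' x (x + t * α) + t * α)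
      (-(f' (x + t * α) * α) / f' x + α) t := by
    filter_upwards [nhdsWithin_le_nhds hnear] with t ht
    have h1 : HasDerivAt (fun t => f (x + t * α)) (f' (x + t * α) * α) t :=
      (hf _ ht).comp t (hline t)
    have h2 := ((h1.const_sub (f x)).div_const (f' x)).add ((hasDerivAt_id t).mul_const α)
    exact h2.congr_deriv (by simp)
  have hden : ∀ᶠ t in 𝓝[>] (0 : ℝ), HasDerivAt (fun t : ℝ => t ^ 2) (2 * t) t :=
    Eventually.of_forall fun t => by simpa using hasDerivAt_pow 2 t
  refine HasDerivAt.lhopital_zero_nhdsGT hnum hden ?_ ?_ ?_ ?_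
  · filter_upwards [self_mem_nhdsWithin] with t ht
    exact mul_ne_zero two_ne_zero (ne_of_gt ht)
  · have hc : ContinuousAt (fun t => divTerm f f' x (x + t * α) + t * α) 0 := by
      have h1 : ContinuousAt (fun t => f (x + t * α)) 0 :=
        ContinuousAt.comp (f := fun t => x + t * α) (by simpa using (hf x hx).continuousAt)
          (hline 0).continuousAt
      exact ((continuousAt_const.sub h1).div_const _).add (continuousAt_id.mul continuousAt_const)
    have := hc.tendsto
    simp only [divTerm, zero_mul, add_zero, sub_self, zero_div] at this
    exact this.mono_left nhdsWithin_le_nhds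
  · have : Tendsto (fun t : ℝ => t ^ 2) (𝓝 0) (𝓝 0) := by
      simpa using (continuous_pow (M := ℝ) 2).tendsto 0
    exact this.mono_left nhdsWithin_le_nhds
  · have h1 : HasDerivAt (fun t => f' (x + t * α)) (f'' x * α) 0 :=
      HasDerivAt.comp (h := fun t => x + t * α) 0 (by simpa using hf' x hx) (hline 0)
    have h2 := h1.tendsto_slope_zero_right
    have h3 := h2.const_mul (-α / (2 * f' x))
    have hne := (hpos x hx).ne'
    refine (h3.congr' ?_).trans (le_of_eq ?_)
    · filter_upwards [self_mem_nhdsWithin] with t ht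
      have ht0 : t ≠ 0 := ne_of_gt ht
      simp only [zero_add, zero_mul, add_zero, smul_eq_mul]
      field_simp
      ring
    · congr 1
      field_simp

/-- The local weight inequality obtained by expanding a two-term divergence inequality
to second order at the diagonal. -/
lemma second_order_le (hf : ∀ x, 0 < x → HasDerivAt f (f' x) x)
    (hf' : ∀ x, 0 < x → HasDerivAt f' (f'' x) x) (hpos : ∀ x, 0 < x → 0 < f' x)
    {x y c : ℝ} (hx : 0 < x) (hy : 0 < y) (hxy : x + y < 1) (hc : 0 < c)
    (h : ∀ u v, 0 < u → 0 < v → u + v < 1 →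
      c * divTerm f f' ((x + y) / c) ((u + v) / c) ≤ divTerm f f' x u + divTerm f f' y v)
    (α β : ℝ) :
    c * (-(f'' ((x + y) / c) / f' ((x + y) / c)) * ((α + β) / c) ^ 2) ≤
      -(f'' x / f' x) * α ^ 2 + -(f'' y / f' y) * β ^ 2 := by
  have h1 := tendsto_divTerm_second_order hf hf' hpos hx α
  have h2 := tendsto_divTerm_second_order hf hf' hpos hy β
  have h3 := (tendsto_divTerm_second_order hf hf' hpos (div_pos (add_pos hx hy) hc)
    ((α + β) / c)).const_mul c
  have hnear : ∀ z γ w : ℝ, z < w → ∀ᶠ t in 𝓝[>] (0 : ℝ), z + t * γ < w := fun z γ w hz => by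
    have : ContinuousAt (fun t : ℝ => z + t * γ) 0 := by fun_prop
    exact nhdsWithin_le_nhds (this.eventually (gt_mem_nhds (by simpa using hz)))
  have hle := le_of_tendsto_of_tendsto h3 (h1.add h2) (by
    filter_upwards [self_mem_nhdsWithin, hnear (-x) (-α) 0 (by linarith),
      hnear (-y) (-β) 0 (by linarith), hnear (x + y) (α + β) 1 hxy] with t ht hxt hyt hxyt
    have hk := h (x + t * α) (y + t * β) (by linarith) (by linarith) (by linarith)
    have he : (x + y) / c + t * ((α + β) / c) = (x + t * α + (y + t * β)) / c := by ring
    rw [he, ← add_div, mul_div_assoc']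
    refine div_le_div_of_nonneg_right ?_ (sq_nonneg t)
    have hcc : c * (t * ((α + β) / c)) = t * α + t * β := by field_simp
    linarith)
  linarith

end SecondOrder

/-- In terms of reciprocal weights, the quadratic inequality becomes superadditivity. -/
lemma add_le_of_weighted_sq_le {s₁ s₂ s₃ c : ℝ} (h₁ : 0 < s₁) (h₂ : 0 < s₂) (h₃ : 0 < s₃)
    (hc : 0 < c)
    (h : c * (s₃⁻¹ * ((s₁ + s₂) / c) ^ 2) ≤ s₁⁻¹ * s₁ ^ 2 + s₂⁻¹ * s₂ ^ 2) :
    s₁ + s₂ ≤ c * s₃ := by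
  have e1 : s₁⁻¹ * s₁ ^ 2 + s₂⁻¹ * s₂ ^ 2 = s₁ + s₂ := by field_simp
  have e2 : c * (s₃⁻¹ * ((s₁ + s₂) / c) ^ 2) = (s₁ + s₂) * ((s₁ + s₂) / (c * s₃)) := by
    field_simp
  rw [e1, e2] at h
  have hS : 0 < s₁ + s₂ := by positivity
  have h4 : (s₁ + s₂) / (c * s₃) ≤ 1 := by
    by_contra! hcon
    nlinarith
  rwa [div_le_one (by positivity)] at h4

/-- A positive continuous function on `(0, 1)` which is superadditive and midpoint concave
(on pairs with sum less than `1`) is linear. -/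
lemma linear_of_superadditive_of_midpoint_concave {s : ℝ → ℝ} (hpos : ∀ x, 0 < x → 0 < s x)
    (hcont : ContinuousOn s (Ioi 0))
    (hsup : ∀ x y, 0 < x → 0 < y → x + y < 1 → s x + s y ≤ s (x + y))
    (hmid : ∀ x y, 0 < x → 0 < y → x + y < 1 → s x + s y ≤ 2 * s ((x + y) / 2)) :
    ∃ c, 0 < c ∧ ∀ x ∈ Ioo (0 : ℝ) 1, s x = c * x := by
  have hhalf : ∀ x ∈ Ioo (0 : ℝ) 1, s x = 2 * s (x / 2) := by
    rintro x ⟨hx0, hx1⟩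
    refine le_antisymm ?_ ?_
    · have hc : ContinuousAt (fun y => 2 * s ((x + y) / 2)) 0 := by
        have h1 : ContinuousAt s ((x + 0) / 2) :=
          hcont.continuousAt (Ioi_mem_nhds (by linarith))
        have h2 : ContinuousAt (fun y => s ((x + y) / 2)) 0 :=
          ContinuousAt.comp (f := fun y => (x + y) / 2) h1 (by fun_prop)
        fun_prop
      have ht : Tendsto (fun y => 2 * s ((x + y) / 2)) (𝓝[>] 0) (𝓝 (2 * s (x / 2))) := by
        simpa using hc.tendsto.mono_left nhdsWithin_le_nhds
      refine ge_of_tendsto ht ?_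
      filter_upwards [Ioo_mem_nhdsGT (sub_pos.mpr hx1)] with y hy
      have := hmid x y hx0 hy.1 (by linarith [hy.2])
      linarith [hpos y hy.1]
    · have := hsup (x / 2) (x / 2) (by linarith) (by linarith) (by linarith)
      rw [add_halves] at this
      linarith
  obtain ⟨m, hm, hmin⟩ := (isCompact_Icc (a := (1 / 8 : ℝ)) (b := 1 / 4)).exists_isMinOn
    ⟨1 / 8, by norm_num⟩ (f := fun x => s x / x) (by
      refine (hcont.mono ?_).div continuousOn_id ?_
      · intro x hx
        exact lt_of_lt_of_le (by norm_num) hx.1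
      · intro x hx
        exact (lt_of_lt_of_le (by norm_num : (0 : ℝ) < 1 / 8) hx.1).ne')
  have hm0 : 0 < m := lt_of_lt_of_le (by norm_num) hm.1
  set c := s m / m with hcdef
  have hc : 0 < c := div_pos (hpos m hm0) hm0
  have hsm : s m = c * m := by rw [hcdef]; field_simp
  have hge : ∀ x, 1 / 8 ≤ x → x ≤ 1 / 4 → c * x ≤ s x := fun x h1 h2 =>
    (le_div_iff₀ (by linarith)).mp (hmin (show x ∈ Icc (1 / 8 : ℝ) (1 / 4) from ⟨h1, h2⟩))
  have hge' : ∀ k : ℕ, ∀ x, 0 < x → 1 / 8 ≤ 2 ^ k * x → x ≤ 1 / 4 → c * x ≤ s x := by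
    intro k
    induction k with
    | zero => exact fun x _ h1 h2 => hge x (by simpa using h1) h2
    | succ k ih =>
      intro x hx h1 h2
      rcases le_or_gt (1 / 8) x with h3 | h3
      · exact hge x h3 h2
      · have := ih (2 * x) (by linarith) (by rw [pow_succ] at h1; linarith) (by linarith)
        rw [hhalf (2 * x) ⟨by linarith, by linarith⟩, mul_div_cancel_left₀ x two_ne_zero] at this
        linarith
  have hlow : ∀ x, 0 < x → x ≤ 1 / 4 → c * x ≤ s x := fun x hx h2 => by
    obtain ⟨k, hk⟩ := pow_unbounded_of_one_lt (1 / 8 / x) (one_lt_two (α := ℝ))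
    exact hge' k x hx ((div_lt_iff₀ hx).mp hk).le h2
  have hsmall : ∀ x, 0 < x → x < 1 / 8 → s x = c * x := fun x hx h8 => by
    have hxm : 0 < 2 * m - x := by linarith [hm.1]
    have h1 := hmid x (2 * m - x) hx hxm (by linarith [hm.2])
    have h2 := hlow x hx (by linarith)
    have h4 : c * (2 * m - x) ≤ s (2 * m - x) := by
      rcases le_or_gt (2 * m - x) (1 / 4) with h5 | h5
      · exact hlow _ hxm h5
      · have := hlow ((2 * m - x) / 2) (by linarith) (by linarith [hm.2])
        rw [hhalf (2 * m - x) ⟨hxm, by linarith [hm.2]⟩]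
        linarith
    have h5 : (x + (2 * m - x)) / 2 = m := by ring
    rw [h5, hsm] at h1
    linarith
  refine ⟨c, hc, fun x hx => ?_⟩
  have h0 := hx.1
  have h1 := hx.2
  rw [hhalf x hx, hhalf (x / 2) ⟨by linarith, by linarith⟩,
    hhalf (x / 2 / 2) ⟨by linarith, by linarith⟩, hsmall (x / 2 / 2 / 2) (by linarith) (by linarith)]
  ring

/-- Solving `f' = -c x f''` on `(0, 1)` yields a Tsallis logarithm. -/
lemma eq_tsallisLog_of_ode {f f' f'' : ℝ → ℝ} (hf : ∀ x, 0 < x → HasDerivAt f (f' x) x)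
    (hf' : ∀ x, 0 < x → HasDerivAt f' (f'' x) x) (hpos : ∀ x, 0 < x → 0 < f' x) {c : ℝ}
    (hc : 0 < c) (h : ∀ x ∈ Ioo (0 : ℝ) 1, f' x = -(c * x * f'' x)) :
    ∃ q b a : ℝ, 0 < q ∧ 0 < b ∧ ∀ x ∈ Ioo (0 : ℝ) 1, f x = b * tsallisLog q x - a := by
  have hconst : ∀ g : ℝ → ℝ, (∀ x ∈ Ioo (0 : ℝ) 1, HasDerivAt g 0 x) →
      ∀ x ∈ Ioo (0 : ℝ) 1, g x = g (1 / 2) := fun g hg x hx =>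
    isOpen_Ioo.is_const_of_deriv_eq_zero isPreconnected_Ioo
      (fun y hy => (hg y hy).differentiableAt.differentiableWithinAt)
      (fun y hy => (hg y hy).deriv) hx ⟨by norm_num, by norm_num⟩
  have hfirst := hconst (fun x => x ^ c⁻¹ * f' x) (fun x hx => by
    have h1 := (Real.hasDerivAt_rpow_const (p := c⁻¹) (Or.inl hx.1.ne')).mul (hf' x hx.1)
    refine h1.congr_deriv ?_
    have h0 := hx.1.ne'
    rw [h x hx, Real.rpow_sub_one h0]
    field_simp
    ring)
  set b := (1 / 2 : ℝ) ^ c⁻¹ * f' (1 / 2)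
  have hbpos : 0 < b := mul_pos (Real.rpow_pos_of_pos (by norm_num) _) (hpos _ (by norm_num))
  have hsecond := hconst (fun x => f x - b * tsallisLog c⁻¹ x) (fun x hx => by
    have h1 := (hf x hx.1).sub ((hasDerivAt_tsallisLog c⁻¹ hx.1).const_mul b)
    refine h1.congr_deriv ?_
    have hr : 0 < x ^ c⁻¹ := Real.rpow_pos_of_pos hx.1 _
    rw [← hfirst x hx, Real.rpow_neg hx.1.le, mul_right_comm, mul_inv_cancel₀ hr.ne', one_mul,
      sub_self])
  refine ⟨c⁻¹, b, -(f (1 / 2) - b * tsallisLog c⁻¹ (1 / 2)), inv_pos.mpr hc, hbpos,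
    fun x hx => ?_⟩
  have := hsecond x hx
  linarith

/-- The vector `(x, y, z, …, z)`. -/
def pairConst (m : ℕ) (x y z : ℝ) : Fin (m + 3) → ℝ :=
  Fin.cons x (Fin.cons y fun _ => z)

lemma forall_pairConst {m : ℕ} {x y z : ℝ} {P : ℝ → Prop} (hx : P x) (hy : P y) (hz : P z)
    (i : Fin (m + 3)) : P (pairConst m x y z i) := by
  refine Fin.cases hx (fun i => ?_) i
  refine Fin.cases ?_ (fun j => ?_) i
  · simpa [pairConst] using hy
  · simpa [pairConst] using hz

lemma sum_pairConst₂ (m : ℕ) (g : ℝ → ℝ → ℝ) (x y z u v w : ℝ) :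
    ∑ i, g (pairConst m x y z i) (pairConst m u v w i) = g x u + (g y v + (m + 1) * g z w) := by
  simp [pairConst, Fin.sum_univ_succ (n := m + 2), Fin.sum_univ_succ (n := m + 1)]

lemma sum_pairConst (m : ℕ) (x y z : ℝ) :
    ∑ i, pairConst m x y z i = x + (y + (m + 1) * z) :=
  sum_pairConst₂ m (fun s _ => s) x y z x y z

lemma sum_pairConst_eq_one (m : ℕ) (x y : ℝ) :
    ∑ i, pairConst m x y ((1 - x - y) / (m + 1)) i = 1 := by
  rw [sum_pairConst]
  have : (m + 1 : ℝ) ≠ 0 := by positivity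
  field_simp
  ring

lemma pairConst_pos (m : ℕ) {x y : ℝ} (hx : 0 < x) (hy : 0 < y) (h : x + y < 1)
    (i : Fin (m + 3)) : 0 < pairConst m x y ((1 - x - y) / (m + 1)) i :=
  forall_pairConst (P := fun t => 0 < t) hx hy (div_pos (by linarith) (by positivity)) i

/-- Merging the first two cells. -/
lemma sum_merge_filter (m : ℕ) (p : Fin (m + 3) → ℝ) (j : Fin (m + 2)) :
    ∑ i ∈ Finset.univ.filter
      (fun i => (Fin.cons 0 id : Fin (m + 3) → Fin (m + 2)) i = j), p i =
      (if 0 = j then p 0 else 0) + p j.succ := by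
  rw [Finset.sum_filter, Fin.sum_univ_succ]
  simp

lemma divTerm_subadditive_of_partition {f f' : ℝ → ℝ} {m : ℕ}
    (h : ∀ (k : ℕ) (A : Fin (m + 3) → Fin k), Function.Surjective A →
      ∀ p q : Fin (m + 3) → ℝ, (∀ i, 0 < p i) → (∀ i, 0 < q i) →
        ∑ i, p i = 1 → ∑ i, q i = 1 →
        ∑ j : Fin k, divTerm f f' (∑ i ∈ Finset.univ.filter (fun i => A i = j), p i)
            (∑ i ∈ Finset.univ.filter (fun i => A i = j), q i)
          ≤ ∑ i, divTerm f f' (p i) (q i))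
    {x y u v : ℝ} (hx : 0 < x) (hy : 0 < y) (hxy : x + y < 1)
    (hu : 0 < u) (hv : 0 < v) (huv : u + v < 1) :
    divTerm f f' (x + y) (u + v) ≤ divTerm f f' x u + divTerm f f' y v := by
  have key := h (m + 2) (Fin.cons 0 id) (fun j => ⟨j.succ, by simp⟩) _ _
    (pairConst_pos m hx hy hxy) (pairConst_pos m hu hv huv)
    (sum_pairConst_eq_one m x y) (sum_pairConst_eq_one m u v)
  rw [sum_pairConst₂] at key
  simp only [sum_merge_filter] at key
  rw [Fin.sum_univ_succ] at key
  simp [pairConst, (Fin.succ_ne_zero _).symm] at key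
  linarith

lemma divTerm_midpoint_of_convex {f f' : ℝ → ℝ} {m : ℕ}
    (h : ∀ p₁ p₂ q₁ q₂ : Fin (m + 3) → ℝ,
        (∀ i, 0 < p₁ i) → (∀ i, 0 < p₂ i) → (∀ i, 0 < q₁ i) → (∀ i, 0 < q₂ i) →
        ∑ i, p₁ i = 1 → ∑ i, p₂ i = 1 → ∑ i, q₁ i = 1 → ∑ i, q₂ i = 1 →
        ∀ l ∈ Icc (0 : ℝ) 1,
          ∑ i, divTerm f f' (l * p₁ i + (1 - l) * p₂ i) (l * q₁ i + (1 - l) * q₂ i)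
            ≤ l * ∑ i, divTerm f f' (p₁ i) (q₁ i) + (1 - l) * ∑ i, divTerm f f' (p₂ i) (q₂ i))
    {x y u v : ℝ} (hx : 0 < x) (hy : 0 < y) (hxy : x + y < 1)
    (hu : 0 < u) (hv : 0 < v) (huv : u + v < 1) :
    2 * divTerm f f' ((x + y) / 2) ((u + v) / 2) ≤ divTerm f f' x u + divTerm f f' y v := by
  have key := h _ _ _ _
    (pairConst_pos m hx hy hxy) (pairConst_pos m hy hx (by linarith))
    (pairConst_pos m hu hv huv) (pairConst_pos m hv hu (by linarith))
    (sum_pairConst_eq_one m x y) (sum_pairConst_eq_one m y x)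
    (sum_pairConst_eq_one m u v) (sum_pairConst_eq_one m v u) (1 / 2) ⟨by norm_num, by norm_num⟩
  have hmix : ∀ s t : ℝ, (fun i => 1 / 2 * pairConst m s t ((1 - s - t) / (m + 1)) i +
      (1 - 1 / 2) * pairConst m t s ((1 - t - s) / (m + 1)) i) =
      pairConst m ((s + t) / 2) ((s + t) / 2) ((1 - s - t) / (m + 1)) := fun s t => by
    funext i
    refine Fin.cases ?_ (fun i => ?_) i
    · simp [pairConst]
      ring
    · refine Fin.cases ?_ (fun j => ?_) i
      · simp [pairConst]
        ring
      · simp [pairConst]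
        ring
  have hx' := fun i => congrFun (hmix x y) i
  have hu' := fun i => congrFun (hmix u v) i
  simp only [hx', hu', sum_pairConst₂] at key
  rw [show 1 - y - x = 1 - x - y by ring, show 1 - v - u = 1 - u - v by ring] at key
  linarith

lemma exists_eq_tsallisLog {f f' f'' : ℝ → ℝ} (hf : ∀ x, 0 < x → HasDerivAt f (f' x) x)
    (hf' : ∀ x, 0 < x → HasDerivAt f' (f'' x) x) (hpos : ∀ x, 0 < x → 0 < f' x)
    (hneg : ∀ x, 0 < x → f'' x < 0) (hcont : ContinuousOn f'' (Ioi 0))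
    (hsub : ∀ x y u v, 0 < x → 0 < y → x + y < 1 → 0 < u → 0 < v → u + v < 1 →
      divTerm f f' (x + y) (u + v) ≤ divTerm f f' x u + divTerm f f' y v)
    (hmid : ∀ x y u v, 0 < x → 0 < y → x + y < 1 → 0 < u → 0 < v → u + v < 1 →
      2 * divTerm f f' ((x + y) / 2) ((u + v) / 2) ≤ divTerm f f' x u + divTerm f f' y v) :
    ∃ q b a : ℝ, 0 < q ∧ 0 < b ∧ ∀ x ∈ Ioo (0 : ℝ) 1, f x = b * tsallisLog q x - a := by
  set s : ℝ → ℝ := fun x => -(f' x / f'' x) with hs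
  have hspos : ∀ x, 0 < x → 0 < s x := fun x hx =>
    neg_pos.mpr (div_neg_of_pos_of_neg (hpos x hx) (hneg x hx))
  have hsinv : ∀ x, -(f'' x / f' x) = (s x)⁻¹ := fun x => by
    rw [hs, inv_neg, inv_div]
  have hscont : ContinuousOn s (Ioi 0) :=
    (ContinuousOn.div (fun x hx => (hf' x hx).continuousAt.continuousWithinAt) hcont
      fun x hx => (hneg x hx).ne).neg
  have hweight : ∀ c, 0 < c → (∀ x y u v, 0 < x → 0 < y → x + y < 1 → 0 < u → 0 < v → u + v < 1 →
      c * divTerm f f' ((x + y) / c) ((u + v) / c) ≤ divTerm f f' x u + divTerm f f' y v) →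
      ∀ x y, 0 < x → 0 < y → x + y < 1 → s x + s y ≤ c * s ((x + y) / c) := by
    intro c hc h x y hx hy hxy
    have key := second_order_le hf hf' hpos hx hy hxy hc (fun u v => h x y u v hx hy hxy)
      (s x) (s y)
    simp only [hsinv] at key
    exact add_le_of_weighted_sq_le (hspos x hx) (hspos y hy)
      (hspos _ (div_pos (add_pos hx hy) hc)) hc key
  obtain ⟨c, hc, hlin⟩ := linear_of_superadditive_of_midpoint_concave hspos hscont
    (by simpa using hweight 1 one_pos (by simpa using hsub)) (hweight 2 two_pos hmid)
  refine eq_tsallisLog_of_ode hf hf' hpos hc fun x hx => ?_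
  have hne := (hneg x hx.1).ne
  rw [← hlin x hx, hs]
  field_simp

/-- Proposition 3: for `n ≥ 3`, the generalized divergence `D_φ` satisfies the
partition inequality and is jointly convex if and only if
`φ⁻¹(x) = b · ln_{q₀}(x) − a` on `(0,1)` for some `q₀ > 0`, `b > 0`, `a ∈ ℝ`,
where `ln_{q₀}` is the Tsallis `q₀`-logarithm (and `ln₁ = ln`). Partitions of
`{1,…,n}` are encoded as surjective maps `A : Fin n → Fin k`. -/
theorem partition_and_joint_convexity_iff_tsallis
    (φ φ' φ'' φinv φinv' φinv'' : ℝ → ℝ)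
    (n : ℕ) (hn : 3 ≤ n)
    -- φ is a strictly positive, strictly increasing deformed exponential
    (hφpos : ∀ u, 0 < φ u)
    (hφconv : ConvexOn ℝ Set.univ φ)
    (hφmono : StrictMono φ)
    (hφbot : Tendsto φ atBot (nhds 0))
    (hφtop : Tendsto φ atTop atTop)
    -- φ is twice differentiable with φ' > 0 and φ'' > 0
    (hφd : ∀ u, HasDerivAt φ (φ' u) u)
    (hφd2 : ∀ u, HasDerivAt φ' (φ'' u) u)
    (hφ'pos : ∀ u, 0 < φ' u)
    (hφ''pos : ∀ u, 0 < φ'' u)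
    -- φinv is the inverse of φ
    (hinv_left : ∀ u, φinv (φ u) = u)
    (hinv_right : ∀ x : ℝ, 0 < x → φ (φinv x) = x)
    -- φinv is twice differentiable on (0,∞) with (φ⁻¹)' > 0 and (φ⁻¹)'' continuous, < 0
    (hinvd : ∀ x : ℝ, 0 < x → HasDerivAt φinv (φinv' x) x)
    (hinvd2 : ∀ x : ℝ, 0 < x → HasDerivAt φinv' (φinv'' x) x)
    (hinv'pos : ∀ x : ℝ, 0 < x → 0 < φinv' x)
    (hinv''neg : ∀ x : ℝ, 0 < x → φinv'' x < 0)
    (hinv''cont : ContinuousOn φinv'' (Set.Ioi 0)) :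
    -- partition inequality
    ((∀ (k : ℕ) (A : Fin n → Fin k), Function.Surjective A →
      ∀ p q : Fin n → ℝ, (∀ i, 0 < p i) → (∀ i, 0 < q i) →
        ∑ i, p i = 1 → ∑ i, q i = 1 →
        ∑ j : Fin k,
            (φinv (∑ i ∈ Finset.univ.filter (fun i => A i = j), p i) -
              φinv (∑ i ∈ Finset.univ.filter (fun i => A i = j), q i)) /
              φinv' (∑ i ∈ Finset.univ.filter (fun i => A i = j), p i)
          ≤ ∑ i, (φinv (p i) - φinv (q i)) / φinv' (p i))
    -- and joint convexity
    ∧ (∀ p₁ p₂ q₁ q₂ : Fin n → ℝ,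
        (∀ i, 0 < p₁ i) → (∀ i, 0 < p₂ i) → (∀ i, 0 < q₁ i) → (∀ i, 0 < q₂ i) →
        ∑ i, p₁ i = 1 → ∑ i, p₂ i = 1 → ∑ i, q₁ i = 1 → ∑ i, q₂ i = 1 →
        ∀ l ∈ Set.Icc (0:ℝ) 1,
          ∑ i, (φinv (l * p₁ i + (1 - l) * p₂ i) - φinv (l * q₁ i + (1 - l) * q₂ i)) /
              φinv' (l * p₁ i + (1 - l) * p₂ i)
            ≤ l * ∑ i, (φinv (p₁ i) - φinv (q₁ i)) / φinv' (p₁ i)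
              + (1 - l) * ∑ i, (φinv (p₂ i) - φinv (q₂ i)) / φinv' (p₂ i)))
    ↔ -- φ⁻¹ is (up to scaling and translation) a Tsallis q₀-logarithm on (0,1)
      ∃ q₀ b a : ℝ, 0 < q₀ ∧ 0 < b ∧
        ∀ x ∈ Set.Ioo (0:ℝ) 1,
          φinv x = b * (if q₀ = 1 then Real.log x else (x ^ (1 - q₀) - 1) / (1 - q₀)) - a := by
  constructor
  · rintro ⟨hpart, hconv⟩
    obtain ⟨m, rfl⟩ : ∃ m, n = m + 3 := ⟨n - 3, by omega⟩
    exact exists_eq_tsallisLog hinvd hinvd2 hinv'pos hinv''neg hinv''cont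
      (fun _ _ _ _ hx hy hxy hu hv huv =>
        divTerm_subadditive_of_partition hpart hx hy hxy hu hv huv)
      (fun _ _ _ _ hx hy hxy hu hv huv =>
        divTerm_midpoint_of_convex hconv hx hy hxy hu hv huv)
  · rintro ⟨q₀, b, a, hq, hb, h⟩
    refine ⟨fun k A hA p q hp hq' hps hqs =>
      partition_of_eq_tsallisLog hinvd hq hb h hn hA hp hq' hps hqs, ?_⟩
    intro p₁ p₂ q₁ q₂ hp₁ hp₂ hq₁ hq₂ hsp₁ hsp₂ hsq₁ hsq₂ l hl
    rw [Finset.mul_sum, Finset.mul_sum, ← Finset.sum_add_distrib]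
    have hmem : ∀ {p : Fin n → ℝ}, (∀ i, 0 < p i) → ∑ i, p i = 1 → ∀ i, p i ∈ Ioo (0 : ℝ) 1 :=
      fun hp hs i => ⟨hp i, lt_one_of_sum_eq_one hn hp hs i⟩
    exact Finset.sum_le_sum fun i _ => divTerm_convex_of_eq_tsallisLog hinvd hq hb h hl
      (hmem hp₁ hsp₁ i) (hmem hp₂ hsp₂ i) (hmem hq₁ hsq₁ i) (hmem hq₂ hsq₂ i)
end

section
/- For 0 < q₀ ≤ 1 let ln_{q₀}(x) = (x^{1−q₀} − 1)/(1−q₀) for q₀ < 1 and ln₁(x) = ln x. Then inf_{0<p<q<1} (1/8)·(1/(q−p))·[ −(ln_{q₀})'(q)/(ln_{q₀})'(p) + (ln_{q₀})'(1−q)/(ln_{q₀})'(1−p) ] = q₀/2, i.e., the Pinsker constant of the generalized divergence associated with the Tsallis q₀-exponential equals q₀/2 (in particular the constant equals 1/2 when q₀ = 1, recovering the classical Pinsker constant for the Kullback–Leibler divergence). -/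
open Set

/-- The derivative of the Tsallis logarithm. -/
theorem deriv_tsallis_log {q₀ : ℝ} {lnq : ℝ → ℝ}
    (hlnq : ∀ x : ℝ, lnq x = if q₀ = 1 then Real.log x
      else (x ^ (1 - q₀) - 1) / (1 - q₀)) {x : ℝ} (hx : 0 < x) :
    deriv lnq x = x ^ (-q₀) := by
  rw [funext hlnq]
  by_cases h : q₀ = 1
  · simp [h, Real.rpow_neg_one]
  · have h1 : 1 - q₀ ≠ 0 := sub_ne_zero.mpr (Ne.symm h)
    simp only [h, if_false]
    have hd := ((Real.hasDerivAt_rpow_const (p := 1 - q₀) (Or.inl hx.ne')).sub_const 1).div_const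
      (1 - q₀)
    rw [hd.deriv, mul_div_cancel_left₀ _ h1]
    congr 1
    ring

theorem rpow_neg_div_rpow_neg {x y : ℝ} (q : ℝ) (hx : 0 < x) (hy : 0 < y) :
    x ^ (-q) / y ^ (-q) = (y / x) ^ q := by
  rw [Real.rpow_neg hx.le, Real.rpow_neg hy.le, Real.div_rpow hy.le hx.le, inv_div_inv]

/-- Weighted AM-GM for reciprocals. -/
theorem inv_weighted_le_rpow_mul_rpow {q u t : ℝ} (hq : 0 ≤ q) (hq' : q ≤ 1)
    (hu : 0 < u) (ht : 0 < t) :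
    ((1 - q) * u + q * t)⁻¹ ≤ u ^ (q - 1) * t ^ (-q) := by
  have h := Real.geom_mean_le_arith_mean2_weighted (sub_nonneg.mpr hq') hq hu.le ht.le (by ring)
  have hpos : 0 < u ^ (1 - q) * t ^ q := by positivity
  calc _ ≤ (u ^ (1 - q) * t ^ q)⁻¹ := inv_anti₀ hpos h
    _ = _ := by
      rw [mul_inv, ← Real.rpow_neg hu.le, ← Real.rpow_neg ht.le, neg_sub]

theorem four_le_inv_one_sub_add_inv {m : ℝ} (h0 : 0 < m) (h1 : m < 1) :
    4 ≤ (1 - m)⁻¹ + m⁻¹ := by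
  have h2 : 0 < 1 - m := sub_pos.mpr h1
  rw [inv_add_inv h2.ne' h0.ne', le_div_iff₀ (by positivity)]
  nlinarith [sq_nonneg (2 * m - 1)]

theorem four_mul_sub_le_rpow_sub_rpow {q s t : ℝ} (hq : 0 < q) (hq' : q ≤ 1)
    (hs : 0 < s) (hst : s < t) (ht : t < 1) :
    4 * q * (t - s) ≤ ((1 - s) / (1 - t)) ^ q - (s / t) ^ q := by
  have ht0 : 0 < t := hs.trans hst
  have ht1 : 0 < 1 - t := sub_pos.mpr ht
  let H : ℝ → ℝ := fun u => u ^ q * t ^ (-q) - (1 - u) ^ q * (1 - t) ^ (-q) - 4 * q * u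
  have hH : ∀ u ∈ Icc s t, HasDerivAt H
      (q * u ^ (q - 1) * t ^ (-q) - (-1 * q * (1 - u) ^ (q - 1)) * (1 - t) ^ (-q) - 4 * q * 1)
      u := by
    intro u hu
    have hu0 : u ≠ 0 := (hs.trans_le hu.1).ne'
    have hu1 : 1 - u ≠ 0 := by linarith [hu.2]
    exact (((Real.hasDerivAt_rpow_const (Or.inl hu0)).mul_const _).sub
      ((((hasDerivAt_id u).const_sub 1).rpow_const (Or.inl hu1)).mul_const _)).sub
      ((hasDerivAt_id u).const_mul _)
  have hmono : MonotoneOn H (Icc s t) := by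
    refine monotoneOn_of_hasDerivWithinAt_nonneg (convex_Icc s t)
      (fun u hu => (hH u hu).continuousAt.continuousWithinAt)
      (fun u hu => (hH u (interior_subset hu)).hasDerivWithinAt) ?_
    intro u hu
    have hu' := interior_subset hu
    have hu0 : 0 < u := hs.trans_le hu'.1
    have hu1 : 0 < 1 - u := by linarith [hu'.2]
    have h1 := inv_weighted_le_rpow_mul_rpow hq.le hq' hu0 ht0
    have h2 := inv_weighted_le_rpow_mul_rpow hq.le hq' hu1 ht1
    have hm0 : 0 < (1 - q) * u + q * t := by nlinarith [mul_pos hq ht0]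
    have hm1 : (1 - q) * u + q * t < 1 := by nlinarith [mul_pos hq ht1]
    have h3 := four_le_inv_one_sub_add_inv hm0 hm1
    rw [show (1 - q) * (1 - u) + q * (1 - t) = 1 - ((1 - q) * u + q * t) by ring] at h2
    have h4 := mul_le_mul_of_nonneg_left (h3.trans (add_le_add h2 h1)) hq.le
    linarith
  have hle := hmono (left_mem_Icc.mpr hst.le) (right_mem_Icc.mpr hst.le) hst.le
  simp only [H] at hle
  rw [← Real.rpow_add ht0, ← Real.rpow_add ht1, add_neg_cancel, Real.rpow_zero,
    Real.rpow_zero] at hle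
  rw [Real.div_rpow (by linarith) ht1.le, Real.div_rpow hs.le ht0.le, div_eq_mul_inv,
    div_eq_mul_inv, ← Real.rpow_neg ht1.le, ← Real.rpow_neg ht0.le]
  linarith

theorem one_add_rpow_sub_one_sub_rpow_le {q x : ℝ} (hq : 0 < q) (hq' : q ≤ 1)
    (hx : 0 < x) (hx' : x < 1) :
    (1 + x) ^ q - (1 - x) ^ q ≤ q * x * (1 + (1 - x)⁻¹) := by
  have hx1 : 0 < 1 - x := sub_pos.mpr hx'
  have h1 : (1 + x) ^ q ≤ 1 + q * x :=
    rpow_one_add_le_one_add_mul_self (by linarith) hq.le hq'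
  have h2 : (1 + x / (1 - x)) ^ q ≤ 1 + q * (x / (1 - x)) :=
    rpow_one_add_le_one_add_mul_self (by linarith [div_pos hx hx1]) hq.le hq'
  have h3 : 1 + x / (1 - x) = (1 - x)⁻¹ := by field_simp; ring
  rw [h3, Real.inv_rpow hx1.le, div_eq_mul_inv] at h2
  have h4 : 0 < (1 - x) ^ q := by positivity
  have h5 : 2 - (1 - x) ^ q ≤ ((1 - x) ^ q)⁻¹ := by
    rw [← one_div, le_div_iff₀ h4]
    nlinarith [sq_nonneg ((1 - x) ^ q - 1)]
  linarith

/-- The Pinsker constant of the generalized divergence associated with the Tsallis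
`q₀`-exponential (i.e. with `φ⁻¹ = ln_{q₀}`) equals `q₀/2`, for `0 < q₀ ≤ 1`. -/
theorem pinsker_constant_tsallis
    (q₀ : ℝ) (hq₀ : 0 < q₀) (hq₀' : q₀ ≤ 1)
    (lnq : ℝ → ℝ)
    (hlnq : ∀ x : ℝ, lnq x = if q₀ = 1 then Real.log x
      else (x ^ (1 - q₀) - 1) / (1 - q₀)) :
    sInf {r : ℝ | ∃ s t : ℝ, 0 < s ∧ s < t ∧ t < 1 ∧
        r = 1/8 * (1/(t - s)) *
          (-(deriv lnq t / deriv lnq s) + deriv lnq (1 - t) / deriv lnq (1 - s))}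
      = q₀ / 2 := by
  have hval : ∀ s t : ℝ, 0 < s → s < t → t < 1 →
      -(deriv lnq t / deriv lnq s) + deriv lnq (1 - t) / deriv lnq (1 - s) =
        ((1 - s) / (1 - t)) ^ q₀ - (s / t) ^ q₀ := by
    intro s t hs hst ht
    have ht0 : 0 < t := hs.trans hst
    have ht1 : 0 < 1 - t := sub_pos.mpr ht
    have hs1 : 0 < 1 - s := by linarith
    rw [deriv_tsallis_log hlnq ht0, deriv_tsallis_log hlnq hs, deriv_tsallis_log hlnq ht1,
      deriv_tsallis_log hlnq hs1, rpow_neg_div_rpow_neg _ ht0 hs, rpow_neg_div_rpow_neg _ ht1 hs1]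
    ring
  set S := {r : ℝ | ∃ s t : ℝ, 0 < s ∧ s < t ∧ t < 1 ∧
        r = 1/8 * (1/(t - s)) *
          (-(deriv lnq t / deriv lnq s) + deriv lnq (1 - t) / deriv lnq (1 - s))}
  have hlower : ∀ r ∈ S, q₀ / 2 ≤ r := by
    rintro r ⟨s, t, hs, hst, ht, rfl⟩
    have hts : 0 < t - s := sub_pos.mpr hst
    rw [hval s t hs hst ht]
    calc q₀ / 2 = 1 / 8 * (1 / (t - s)) * (4 * q₀ * (t - s)) := by field_simp; norm_num
      _ ≤ _ := mul_le_mul_of_nonneg_left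
        (four_mul_sub_le_rpow_sub_rpow hq₀ hq₀' hs hst ht) (by positivity)
  have hupper : ∀ x : ℝ, 0 < x → x < 1 → sInf S ≤ q₀ / 4 * (1 + (1 - x)⁻¹) := by
    intro x hx hx'
    have hs : 0 < (1 - x) / 2 := by linarith
    have hst : (1 - x) / 2 < 1 / 2 := by linarith
    refine (csInf_le ⟨q₀ / 2, hlower⟩
      ⟨(1 - x) / 2, 1 / 2, hs, hst, by norm_num, rfl⟩).trans ?_
    rw [hval _ _ hs hst (by norm_num),
      show (1 - (1 - x) / 2) / (1 - 1 / 2) = 1 + x by ring,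
      show (1 - x) / 2 / (1 / 2) = 1 - x by ring,
      show (1 : ℝ) / 2 - (1 - x) / 2 = x / 2 by ring]
    calc _ ≤ 1 / 8 * (1 / (x / 2)) * (q₀ * x * (1 + (1 - x)⁻¹)) :=
          mul_le_mul_of_nonneg_left
            (one_add_rpow_sub_one_sub_rpow_le hq₀ hq₀' hx hx') (by positivity)
      _ = _ := by
        generalize (1 - x)⁻¹ = y
        field_simp
        ring
  apply le_antisymm
  · have hc : ContinuousAt (fun x : ℝ => q₀ / 4 * (1 + (1 - x)⁻¹)) 0 := by
      have : ContinuousAt (fun x : ℝ => (1 - x)⁻¹) 0 :=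
        (continuousAt_const.sub continuousAt_id).inv₀ (by norm_num)
      exact continuousAt_const.mul (continuousAt_const.add this)
    have hlim := hc.tendsto.mono_left (nhdsWithin_le_nhds (s := Ioi (0 : ℝ)))
    rw [show q₀ / 4 * (1 + (1 - (0 : ℝ))⁻¹) = q₀ / 2 by norm_num; ring] at hlim
    refine ge_of_tendsto hlim ?_
    filter_upwards [Ioo_mem_nhdsGT (zero_lt_one' ℝ)] with x hx
    exact hupper x hx.1 hx.2
  · refine le_csInf ⟨_, 1 / 4, 1 / 2, by norm_num, by norm_num, by norm_num, rfl⟩ hlower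
end
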